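/- arXiv:1909.04859 — 2 statements merged into one kernel-verified Lean document; each statement's English description precedes it below -/
import Mathlib

section
/- Let C ⊂ P^{1+c}, c ≥ 4, be a nondegenerate integral projective curve of arithmetic genus 1 and degree d = c+3. Then C is the only nondegenerate irreducible component of Q(C) = Bs(|I_C(2)|). -/
/-!
Common framework: a projective variety `X ⊆ ℙ^N` over a field `k` is represented by its
affine cone `C ⊆ (ι → k)` (with `ι` the index type of homogeneous coordinates,
`Fintype.card ι = N + 1`).  All projective notions (vanishing ideal, `a₂`, Hilbert
function, dimension, degree, depth, base locus of quadrics, irreducible components,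
scrolls and divisors on them, sectional genus, maximal sectional regularity) are
defined concretely below.
-/

open MvPolynomial

noncomputable section

namespace PaperQuadrics

variable (k : Type) [Field k] (ι : Type) [Fintype ι] [DecidableEq ι]

/-- The vanishing ideal of a subset `C` of the affine cone `ι → k`. -/
def vanIdeal (C : Set (ι → k)) : Ideal (MvPolynomial ι k) :=
  ⨅ x ∈ C, RingHom.ker (MvPolynomial.eval x)

/-- The degree-`m` graded piece of an ideal of the polynomial ring. -/
def idealPiece (I : Ideal (MvPolynomial ι k)) (m : ℕ) : Submodule k (MvPolynomial ι k) :=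
  Submodule.restrictScalars k I ⊓ homogeneousSubmodule ι k m

/-- The space of quadrics vanishing on `C`, i.e. `H⁰(ℙ^N, I_C(2))`. -/
def quadrics (C : Set (ι → k)) : Submodule k (MvPolynomial ι k) :=
  idealPiece k ι (vanIdeal k ι C) 2

/-- `a₂(C) = h⁰(ℙ^N, I_C(2))`, the number of linearly independent quadrics through `C`. -/
def a2 (C : Set (ι → k)) : ℕ := Module.finrank k (quadrics k ι C)

/-- The Hilbert function of `R/I` in degree `m`. -/
def idealHilb (I : Ideal (MvPolynomial ι k)) (m : ℕ) : ℕ :=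
  Module.finrank k (homogeneousSubmodule ι k m) - Module.finrank k (idealPiece k ι I m)

/-- The Hilbert function of the homogeneous coordinate ring of `C`. -/
def hilb (C : Set (ι → k)) (m : ℕ) : ℕ := idealHilb k ι (vanIdeal k ι C) m

/-- `C ⊆ ι → k` is the affine cone of an irreducible projective variety:
it is a Zariski-closed cone whose vanishing ideal is prime. -/
structure IsProjVariety (C : Set (ι → k)) : Prop where
  zero_mem : (0 : ι → k) ∈ C
  smul_mem : ∀ x ∈ C, ∀ t : k, t • x ∈ C
  closed : C = {x | ∀ f ∈ vanIdeal k ι C, MvPolynomial.eval x f = 0}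
  prime : (vanIdeal k ι C).IsPrime

/-- Nondegenerate: no nonzero linear form vanishes identically on `C`. -/
def Nondeg (C : Set (ι → k)) : Prop :=
  ∀ f ∈ homogeneousSubmodule ι k 1, (∀ x ∈ C, MvPolynomial.eval x f = 0) → f = 0

/-- The projective variety with cone `C` has dimension `n`
(so the affine cone has Krull dimension `n + 1`). -/
def HasDim (C : Set (ι → k)) (n : ℕ) : Prop :=
  ringKrullDim (MvPolynomial ι k ⧸ vanIdeal k ι C) = (n + 1 : ℕ)

/-- `C` (of projective dimension `n`) has degree `d`:
the Hilbert function satisfies `hF(m) · n! / mⁿ → d`. -/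
def HasDegree (C : Set (ι → k)) (n d : ℕ) : Prop :=
  Filter.Tendsto (fun m : ℕ => (hilb k ι C m : ℝ) * (Nat.factorial n : ℝ) / (m : ℝ) ^ n)
    Filter.atTop (nhds (d : ℝ))

/-- `Q(C)`: the common zero set (base locus) of all quadrics through `C`. -/
def quadZero (C : Set (ι → k)) : Set (ι → k) :=
  {x | ∀ f ∈ quadrics k ι C, MvPolynomial.eval x f = 0}

/-- `fs` is a regular sequence on `R/I`. -/
def IsRegSeqOn (I : Ideal (MvPolynomial ι k)) (fs : List (MvPolynomial ι k)) : Prop :=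
  (∀ i : Fin fs.length, ∀ g : MvPolynomial ι k,
      fs.get i * g ∈ I ⊔ Ideal.span {h | ∃ j : Fin fs.length, j < i ∧ fs.get j = h} →
      g ∈ I ⊔ Ideal.span {h | ∃ j : Fin fs.length, j < i ∧ fs.get j = h}) ∧
  I ⊔ Ideal.span {h | ∃ j : Fin fs.length, fs.get j = h} ≠ ⊤

/-- Arithmetic depth of the homogeneous coordinate ring of `C`: the supremum of lengths of
regular sequences of elements of the irrelevant maximal ideal. -/
def arithDepth (C : Set (ι → k)) : ℕ :=
  sSup {l : ℕ | ∃ fs : List (MvPolynomial ι k), fs.length = l ∧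
    (∀ f ∈ fs, MvPolynomial.coeff 0 f = 0) ∧ IsRegSeqOn k ι (vanIdeal k ι C) fs}

/-- `Z` is an irreducible Zariski-closed cone. -/
def IsIrredClosed (Z : Set (ι → k)) : Prop :=
  Z = {x | ∀ f ∈ vanIdeal k ι Z, MvPolynomial.eval x f = 0} ∧ (vanIdeal k ι Z).IsPrime

/-- `Z` is an irreducible component of `Q`: an irreducible closed subset of `Q`, maximal
among the irreducible closed subsets of `Q`. -/
def IsComponentOf (Z Q : Set (ι → k)) : Prop :=
  IsIrredClosed k ι Z ∧ Z ⊆ Q ∧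
    ∀ Z' : Set (ι → k), IsIrredClosed k ι Z' → Z ⊆ Z' → Z' ⊆ Q → Z' = Z

/-- `C` is smooth away from the cone vertex, of codimension `c`: at each nonzero point the
Jacobian of the vanishing ideal has rank `c` (valid criterion in characteristic `0`). -/
def IsSmoothOfCodim (C : Set (ι → k)) (c : ℕ) : Prop :=
  ∀ x ∈ C, x ≠ (0 : ι → k) →
    Module.finrank k (Submodule.span k
      {v : ι → k | ∃ f ∈ vanIdeal k ι C,
        v = fun i => MvPolynomial.eval x (MvPolynomial.pderiv i f)}) = c

/-- The projective variety with affine cone `C` is a cone (in the projective sense):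
there is a vertex point `[v]` such that `C` is stable under the join with `[v]`. -/
def IsConeVariety (C : Set (ι → k)) : Prop :=
  ∃ v ∈ C, v ≠ 0 ∧ ∀ x ∈ C, ∀ s t : k, s • x + t • v ∈ C

/-- `C` (an `n`-dimensional variety of degree `d`) has sectional genus `g`: a general linear
curve section (cut by `n - 1` general hyperplanes) has Hilbert polynomial `d·m + 1 - g`. -/
def SectionalGenus (n : ℕ) (C : Set (ι → k)) (d g : ℕ) : Prop :=
  ∃ P : MvPolynomial (Fin (n - 1) × ι) k, P ≠ 0 ∧
    ∀ w : Fin (n - 1) → ι → k, MvPolynomial.eval (fun q => w q.1 q.2) P ≠ 0 →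
      ∀ᶠ m in Filter.atTop,
        (hilb k ι (C ∩ {x | ∀ j, ∑ i, w j i * x i = 0}) m : ℤ) = d * m + 1 - g

/-- `C` (an `n`-dimensional variety of degree `c + 3`) is a variety of maximal sectional
regularity: there is an `n`-dimensional linear subspace `F(X) = ℙ(L)` such that
`X ∩ F(X)` is (scheme-theoretically) a hypersurface of degree `4` in `F(X) ≅ ℙⁿ`,
detected by the Hilbert function of the ideal sum. -/
def IsVMSR (n : ℕ) (C : Set (ι → k)) : Prop :=
  ∃ L : Submodule k (ι → k), Module.finrank k L = n + 1 ∧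
    ∀ᶠ m in Filter.atTop,
      idealHilb k ι (vanIdeal k ι C ⊔ vanIdeal k ι (L : Set (ι → k))) m =
        Nat.choose (m + n) n - Nat.choose (m - 4 + n) n

end PaperQuadrics

namespace PaperQuadrics

variable {k : Type} [Field k]

/-- The parametrization of the rational normal scroll `S(a₀, …, aₙ)` (so the scroll has
dimension `n + 1`): homogeneous coordinates are indexed by `(i, j)`, `0 ≤ j ≤ aᵢ`,
and the point of parameters `(s : t) ∈ ℙ¹`, `λ` has coordinates `λᵢ sʲ t^{aᵢ - j}`. -/
def scrollParam (n : ℕ) (a : Fin (n + 1) → ℕ) (s t : k) (lam : Fin (n + 1) → k) :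
    ((i : Fin (n + 1)) × Fin (a i + 1)) → k :=
  fun x => lam x.1 * s ^ (x.2 : ℕ) * t ^ (a x.1 - (x.2 : ℕ))

/-- The affine cone of the scroll `S(a₀, …, aₙ) ⊆ ℙ^{n+1+c-1}`, `c = Σ aᵢ`. -/
def scrollCone (n : ℕ) (a : Fin (n + 1) → ℕ) :
    Set (((i : Fin (n + 1)) × Fin (a i + 1)) → k) :=
  {v | ∃ s t lam, v = scrollParam n a s t lam}

/-- Global sections of `O_Y(A·H + b·F)` on the scroll `Y = S(a₀, …, aₙ)`, realized as
bihomogeneous polynomials in `s, t` (the `ℙ¹`-coordinates) and `T₀, …, Tₙ` (the fiber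
coordinates): each monomial has total `T`-degree `A` and `(s,t)`-degree `b + Σ mᵢ aᵢ`. -/
def sectionSpace (k : Type) [Field k] (n : ℕ) (a : Fin (n + 1) → ℕ) (A b : ℤ) :
    Submodule k (MvPolynomial (Fin 2 ⊕ Fin (n + 1)) k) where
  carrier := {F | ∀ m ∈ F.support,
    ((∑ i, m (Sum.inr i) : ℕ) : ℤ) = A ∧
    ((m (Sum.inl 0) + m (Sum.inl 1) : ℕ) : ℤ)
      = b + ∑ i, (m (Sum.inr i) : ℤ) * (a i : ℤ)}
  add_mem' := by
    intro p q hp hq m hm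
    rcases Finset.mem_union.mp (MvPolynomial.support_add hm) with h | h
    · exact hp m h
    · exact hq m h
  zero_mem' := by
    intro m hm
    simp at hm
  smul_mem' := by
    intro c p hp m hm
    exact hp m (MvPolynomial.support_smul hm)

/-- The affine cone of the effective divisor `X ≡ A·H + b·F` on the scroll cut out by a
section `F`: the points of the scroll whose parameters are zeros of `F`. -/
def divisorCone (n : ℕ) (a : Fin (n + 1) → ℕ)
    (F : MvPolynomial (Fin 2 ⊕ Fin (n + 1)) k) :
    Set (((i : Fin (n + 1)) × Fin (a i + 1)) → k) :=
  {v | ∃ s t lam, v = scrollParam n a s t lam ∧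
     MvPolynomial.eval (Sum.elim (fun j : Fin 2 => if j = 0 then s else t) lam) F = 0}

end PaperQuadrics

open PaperQuadrics

set_option linter.unusedSectionVars false

theorem mulLeft_injective_of_ne_zero {k R : Type*} [Field k] [CommRing R] [IsDomain R]
    [Algebra k R] {x : R} (hx : x ≠ 0) : Function.Injective (LinearMap.mulLeft k x) :=
  fun _ _ h => mul_left_cancel₀ hx h

theorem exists_eq_smul_of_mul_mem {k R : Type*} [Field k] [IsAlgClosed k] [CommRing R] [IsDomain R]
    [Algebra k R] {a y : R} (hy : y ≠ 0) (W : Submodule k R) [FiniteDimensional k W] (hW : W ≠ ⊥)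
    (h : ∀ r ∈ W, ∃ s ∈ W, a * r = y * s) : ∃ μ : k, a = μ • y := by
  choose! f hfW hf using h
  let T : Module.End k W :=
    { toFun := fun r => ⟨f r, hfW r r.2⟩
      map_add' := fun r s => by
        apply Subtype.ext
        apply mul_left_cancel₀ hy
        have := hf _ (r + s).2
        simp only [Submodule.coe_add] at this ⊢
        rw [← this, mul_add, mul_add, hf _ r.2, hf _ s.2]
      map_smul' := fun c r => by
        apply Subtype.ext
        apply mul_left_cancel₀ hy
        have := hf _ (c • r).2
        simp only [Submodule.coe_smul, RingHom.id_apply] at this ⊢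
        rw [← this, mul_smul_comm, mul_smul_comm, hf _ r.2] }
  have : Nontrivial W := Submodule.nontrivial_iff_ne_bot.mpr hW
  obtain ⟨μ, hμ⟩ := Module.End.exists_eigenvalue T
  obtain ⟨w, hw⟩ := hμ.exists_hasEigenvector
  refine ⟨μ, ?_⟩
  have h1 : f w = μ • (w : R) := congrArg Subtype.val hw.apply_eq_smul
  have h2 := hf _ w.2
  rw [h1] at h2
  have h3 : (w : R) ≠ 0 := fun h => hw.2 (Subtype.ext h)
  apply mul_right_cancel₀ h3
  rw [h2, mul_smul_comm, smul_mul_assoc]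

theorem two_mul_finrank_le_of_pencil {k R : Type*} [Field k] [IsAlgClosed k] [CommRing R]
    [IsDomain R] [Algebra k R] {x y : R} (hy : y ≠ 0) (L W W' : Submodule k R)
    [FiniteDimensional k L] [FiniteDimensional k W] (hW : W ≠ ⊥)
    (hgen : ∀ r ∈ W, ∃ u ∈ W', ∃ v ∈ W', r = x * u + y * v)
    (hmul : ∀ a ∈ L, ∀ u ∈ W', a * u ∈ W) :
    2 * Module.finrank k L ≤ Module.finrank k
      ↥(L.map (LinearMap.mulLeft k x) ⊔ L.map (LinearMap.mulLeft k y)) + 1 := by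
  have h1 := Submodule.finrank_sup_add_finrank_inf_eq (L.map (LinearMap.mulLeft k x))
    (L.map (LinearMap.mulLeft k y))
  by_cases hx : x = 0
  · subst hx
    have h5 : Module.finrank k L ≤ 1 := by
      have : L ≤ Submodule.span k {y} := by
        intro a ha
        obtain ⟨μ, hμ⟩ := exists_eq_smul_of_mul_mem (k := k) (a := a) hy W hW (by
          intro r hr
          obtain ⟨u, -, v, hv, e⟩ := hgen r hr
          refine ⟨a * v, hmul a ha v hv, ?_⟩
          rw [e]; ring)
        exact Submodule.mem_span_singleton.mpr ⟨μ, hμ.symm⟩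
      exact (Submodule.finrank_mono this).trans (finrank_span_le_card {y} |>.trans (by simp))
    have h6 : Module.finrank k L = Module.finrank k (L.map (LinearMap.mulLeft k y)) :=
      (LinearEquiv.finrank_eq (Submodule.equivMapOfInjective _ (mulLeft_injective_of_ne_zero hy) L))
    have h7 := Submodule.finrank_mono (le_sup_right : L.map (LinearMap.mulLeft k y) ≤
      L.map (LinearMap.mulLeft k 0) ⊔ L.map (LinearMap.mulLeft k y))
    omega
  have h2 : Module.finrank k L = Module.finrank k (L.map (LinearMap.mulLeft k x)) :=
    (LinearEquiv.finrank_eq (Submodule.equivMapOfInjective _ (mulLeft_injective_of_ne_zero hx) L))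
  have h3 : Module.finrank k L = Module.finrank k (L.map (LinearMap.mulLeft k y)) :=
    (LinearEquiv.finrank_eq (Submodule.equivMapOfInjective _ (mulLeft_injective_of_ne_zero hy) L))
  have h4 : Module.finrank k ↥(L.map (LinearMap.mulLeft k x) ⊓ L.map (LinearMap.mulLeft k y)) ≤ 1 := by
    have : L.map (LinearMap.mulLeft k x) ⊓ L.map (LinearMap.mulLeft k y)
        ≤ Submodule.span k {x * y} := by
      rintro _ ⟨⟨a, ha, rfl⟩, ⟨b, hb, hab⟩⟩
      simp only [LinearMap.mulLeft_apply] at hab ⊢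
      obtain ⟨μ, hμ⟩ := exists_eq_smul_of_mul_mem (k := k) (a := a) hy W hW (by
          intro r hr
          obtain ⟨u, hu, v, hv, e⟩ := hgen r hr
          refine ⟨a * v + b * u, W.add_mem (hmul a ha v hv) (hmul b hb u hu), ?_⟩
          rw [e]; linear_combination -u * hab)
      exact Submodule.mem_span_singleton.mpr ⟨μ, by rw [hμ, mul_smul_comm]⟩
    exact (Submodule.finrank_mono this).trans (finrank_span_le_card {x * y} |>.trans (by simp))
  omega

/-- A graded piece structure on a commutative algebra, generated in degree one. -/
structure StdGrading (k : Type*) {R : Type*} [Field k] [CommRing R] [Algebra k R]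
    (G : ℕ → Submodule k R) : Prop where
  fd : ∀ m, FiniteDimensional k (G m)
  mul_mem : ∀ a b, ∀ x ∈ G a, ∀ y ∈ G b, x * y ∈ G (a + b)
  gen : ∀ m, G (m + 1) ≤ G 1 * G m

namespace StdGrading

variable {k R : Type*} [Field k] [CommRing R] [Algebra k R] {G : ℕ → Submodule k R}

theorem mul_mem_succ (hG : StdGrading k G) {m : ℕ} {x y : R} (hx : x ∈ G 1) (hy : y ∈ G m) :
    x * y ∈ G (m + 1) := by
  rw [add_comm m 1]; exact hG.mul_mem _ _ _ hx _ hy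

theorem pow_mul_mem (hG : StdGrading k G) {m : ℕ} {x y : R} (hx : x ∈ G 1) (hy : y ∈ G m) (j : ℕ) :
    x ^ j * y ∈ G (m + j) := by
  induction j with
  | zero => simpa using hy
  | succ j ih => rw [pow_succ', mul_assoc]; exact hG.mul_mem_succ hx ih

theorem eq_add_pow_mul (hG : StdGrading k G) {l y : R} (hy : y ∈ G 1) {m : ℕ}
    (h : ∀ m' ≥ m, ∀ r ∈ G (m' + 1), ∃ u ∈ G m', ∃ v ∈ G m', r = l * u + y * v) (j : ℕ) :
    ∀ r ∈ G (m + j + 1), ∃ u ∈ G (m + j), ∃ v ∈ G m, r = l * u + y ^ (j + 1) * v := by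
  induction j with
  | zero => simpa using h m le_rfl
  | succ j ih =>
    intro r hr
    obtain ⟨u, hu, v, hv, rfl⟩ := h (m + (j + 1)) (by omega) r hr
    obtain ⟨u', hu', v', hv', rfl⟩ := ih v hv
    refine ⟨u + y * u', Submodule.add_mem _ hu (hG.mul_mem_succ hy hu'), v', hv', ?_⟩
    ring

/-- Elements of degree `m` that become divisible by `l` after multiplication by a power of `y`. -/
def satDiv (hG : StdGrading k G) (l : R) {y : R} (hy : y ∈ G 1) (m : ℕ) : Submodule k R where
  carrier := {x | x ∈ G m ∧ ∃ j, ∃ g ∈ G (m + j), y ^ (j + 1) * x = l * g}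
  add_mem' := by
    rintro a b ⟨ha, i, g, hg, e⟩ ⟨hb, j, g', hg', e'⟩
    refine ⟨Submodule.add_mem _ ha hb, i + j, y ^ j * g + y ^ i * g', ?_, ?_⟩
    · apply Submodule.add_mem
      · rw [← add_assoc]; exact hG.pow_mul_mem hy hg j
      · rw [add_comm i, ← add_assoc]; exact hG.pow_mul_mem hy hg' i
    · linear_combination y ^ j * e + y ^ i * e'
  zero_mem' := ⟨Submodule.zero_mem _, 0, 0, Submodule.zero_mem _, by simp⟩
  smul_mem' := by
    rintro c a ⟨ha, i, g, hg, e⟩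
    refine ⟨Submodule.smul_mem _ _ ha, i, c • g, Submodule.smul_mem _ _ hg, ?_⟩
    rw [mul_smul_comm, e, mul_smul_comm]

theorem finrank_two_le [IsAlgClosed k] [IsDomain R] (hG : StdGrading k G) {l y : R}
    (hl : l ∈ G 1) (hy : y ∈ G 1) (hl0 : l ≠ 0) (hy0 : y ≠ 0) {N n : ℕ}
    (hgen : ∀ m ≥ N, ∀ r ∈ G (m + 1), ∃ u ∈ G m, ∃ v ∈ G m, r = l * u + y * v)
    (hN : ∀ m ≥ N, Module.finrank k (G m) = (n + 1) * m) (hn : Module.finrank k (G 1) = n) :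
    Module.finrank k (G 2) ≤ 2 * (n + 1) := by
  have := hG.fd
  set J := hG.satDiv l hy with hJ
  have hJG : ∀ m, J m ≤ G m := fun m x hx => hx.1
  have hJfd : ∀ m, FiniteDimensional k (J m) := fun m =>
    Submodule.finiteDimensional_of_le (hJG m)
  have hmapfin : ∀ {z : R}, z ≠ 0 → ∀ W : Submodule k R,
      Module.finrank k (W.map (LinearMap.mulLeft k z)) = Module.finrank k W := fun hz W =>
    (LinearEquiv.finrank_eq (Submodule.equivMapOfInjective _ (mulLeft_injective_of_ne_zero hz) W)).symm
  have hJmul : ∀ m, ∀ z ∈ G 1, ∀ x ∈ J m, z * x ∈ J (m + 1) := by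
    rintro m z hz x ⟨hx, j, g, hg, e⟩
    refine ⟨hG.mul_mem_succ hz hx, j, z * g, ?_, by linear_combination z * e⟩
    have := hG.mul_mem_succ hz hg
    rwa [show m + 1 + j = m + j + 1 by omega]
  have hJdiv : ∀ m, ∀ x ∈ G m, y * x ∈ J (m + 1) → x ∈ J m := by
    rintro m x hx ⟨-, j, g, hg, e⟩
    refine ⟨hx, j + 1, g, ?_, by rw [← e]; ring⟩
    rwa [show m + (j + 1) = m + 1 + j by omega]
  have hlJ : ∀ m, (G m).map (LinearMap.mulLeft k l) ≤ J (m + 1) := by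
    rintro m _ ⟨x, hx, rfl⟩
    refine ⟨hG.mul_mem_succ hl hx, 0, y * x, hG.mul_mem_succ hy hx, ?_⟩
    simp only [LinearMap.mulLeft_apply]; ring
  -- `J 1` is spanned by `l`
  have hGN : G (N + 1) ≠ ⊥ := by
    intro h
    have := hN (N + 1) (by omega)
    rw [h] at this
    simp at this
  have hJ1 : Module.finrank k (J 1) ≤ 1 := by
    have : J 1 ≤ Submodule.span k {l} := by
      rintro x ⟨hx, j, g, hg, e⟩
      have hWb : G (N + j + 1) ≠ ⊥ := by
        intro h
        have := hN (N + j + 1) (by omega)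
        rw [h] at this
        simp at this
      obtain ⟨μ, hμ⟩ := exists_eq_smul_of_mul_mem (k := k) (a := x) hl0 (G (N + j + 1)) hWb (by
        intro r hr
        obtain ⟨u, hu, v, hv, rfl⟩ := hG.eq_add_pow_mul hy hgen j r hr
        refine ⟨x * u + g * v, Submodule.add_mem _ (hG.mul_mem_succ hx hu) ?_, ?_⟩
        · have := hG.mul_mem _ _ _ hg _ hv
          rwa [show N + j + 1 = 1 + j + N by omega]
        · linear_combination v * e)
      exact Submodule.mem_span_singleton.mpr ⟨μ, hμ.symm⟩
    exact (Submodule.finrank_mono this).trans (finrank_span_le_card {l} |>.trans (by simp))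
  -- eventually `J` is the ideal generated by `l`
  have hcancel : ∀ m ≥ N, ∀ x ∈ G (m + 1), ∀ g ∈ G (m + 1), y * x = l * g → ∃ c ∈ G m, x = l * c := by
    intro m hm x hx g hg e
    set A := (G (m + 1)).map (LinearMap.mulLeft k y)
    set B := (G (m + 1)).map (LinearMap.mulLeft k l)
    have h1 := Submodule.finrank_sup_add_finrank_inf_eq A B
    have h2 : A ⊔ B = G (m + 1 + 1) := by
      apply le_antisymm
      · rw [sup_le_iff]
        constructor
        · rintro _ ⟨x, hx, rfl⟩; exact hG.mul_mem_succ hy hx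
        · rintro _ ⟨x, hx, rfl⟩; exact hG.mul_mem_succ hl hx
      · intro r hr
        obtain ⟨u, hu, v, hv, rfl⟩ := hgen (m + 1) (by omega) r hr
        rw [add_comm]
        exact Submodule.add_mem_sup ⟨v, hv, rfl⟩ ⟨u, hu, rfl⟩
    rw [h2, hmapfin hy0, hmapfin hl0, hN _ (by omega), hN _ (by omega)] at h1
    have h3 : (G m).map (LinearMap.mulLeft k (y * l)) ≤ A ⊓ B := by
      rintro _ ⟨c, hc, rfl⟩
      refine ⟨⟨l * c, hG.mul_mem_succ hl hc, ?_⟩, ⟨y * c, hG.mul_mem_succ hy hc, ?_⟩⟩ <;>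
        simp only [LinearMap.mulLeft_apply] <;> ring
    have : FiniteDimensional k ↥(A ⊓ B) := Submodule.finiteDimensional_inf_left A B
    have h4 : (G m).map (LinearMap.mulLeft k (y * l)) = A ⊓ B := by
      apply Submodule.eq_of_le_of_finrank_le h3
      rw [hmapfin (mul_ne_zero hy0 hl0), hN _ hm]
      nlinarith
    have h5 : y * x ∈ A ⊓ B := ⟨⟨x, hx, rfl⟩, ⟨g, hg, e.symm⟩⟩
    rw [← h4] at h5
    obtain ⟨c, hc, e'⟩ := h5
    refine ⟨c, hc, mul_left_cancel₀ hy0 ?_⟩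
    rw [← e']; simp
  have hJbig : ∀ m ≥ N, J (m + 1) ≤ (G m).map (LinearMap.mulLeft k l) := by
    rintro m hm x ⟨hx, j, g, hg, e⟩
    suffices H : ∀ i ≤ j + 1, ∃ g ∈ G (m + i), y ^ i * x = l * g by
      obtain ⟨c, hc, e⟩ := H 0 (by omega)
      exact ⟨c, hc, by simpa using e.symm⟩
    intro i hi
    induction hi using Nat.decreasingInduction with
    | self => exact ⟨g, by rwa [show m + (j + 1) = m + 1 + j by omega], e⟩
    | of_succ i _ ih =>
      obtain ⟨g, hg, e⟩ := ih
      obtain ⟨c, hc, hc'⟩ := hcancel (m + i) (by omega) (y ^ i * x) (by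
        have := hG.pow_mul_mem hy hx i
        rwa [show m + i + 1 = m + 1 + i by omega]) g hg (by rw [← e]; ring)
      exact ⟨c, hc, hc'⟩
  have hinf : ∀ m, (G m).map (LinearMap.mulLeft k y) ⊓ J (m + 1) = (J m).map (LinearMap.mulLeft k y) := by
    intro m
    apply le_antisymm
    · rintro _ ⟨⟨x, hx, rfl⟩, hx'⟩
      exact ⟨x, hJdiv m x hx hx', rfl⟩
    · rintro _ ⟨x, hx, rfl⟩
      exact ⟨⟨x, hJG m hx, rfl⟩, hJmul m y hy x hx⟩
  have hsup : ∀ m, (G m).map (LinearMap.mulLeft k y) ⊔ J (m + 1) ≤ G (m + 1) := by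
    intro m
    rw [sup_le_iff]
    refine ⟨?_, hJG _⟩
    rintro _ ⟨x, hx, rfl⟩; exact hG.mul_mem_succ hy hx
  have hrank : ∀ m, Module.finrank k ↥((G m).map (LinearMap.mulLeft k y) ⊔ J (m + 1))
      + Module.finrank k (J m) = Module.finrank k (G m) + Module.finrank k (J (m + 1)) := by
    intro m
    have := Submodule.finrank_sup_add_finrank_inf_eq ((G m).map (LinearMap.mulLeft k y)) (J (m + 1))
    rwa [hinf, hmapfin hy0, hmapfin hy0] at this
  have hmono : ∀ m, Module.finrank k (G m) + Module.finrank k (J (m + 1)) ≤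
      Module.finrank k (G (m + 1)) + Module.finrank k (J m) := by
    intro m
    rw [← hrank m]
    exact Nat.add_le_add_right (Submodule.finrank_mono (hsup m)) _
  have hstat : ∀ m, Module.finrank k (G m) + Module.finrank k (J (m + 1)) =
      Module.finrank k (G (m + 1)) + Module.finrank k (J m) →
      Module.finrank k (G (m + 1)) + Module.finrank k (J (m + 2)) =
      Module.finrank k (G (m + 2)) + Module.finrank k (J (m + 1)) := by
    intro m h
    have h1 : (G m).map (LinearMap.mulLeft k y) ⊔ J (m + 1) = G (m + 1) :=
      Submodule.eq_of_le_of_finrank_le (hsup m) (by have := hrank m; omega)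
    have h2 : (G (m + 1)).map (LinearMap.mulLeft k y) ⊔ J (m + 2) = G (m + 2) := by
      apply le_antisymm (hsup (m + 1))
      refine (hG.gen (m + 1)).trans ?_
      rw [Submodule.mul_le]
      intro z hz x hx
      rw [← h1] at hx
      obtain ⟨_, ⟨a, ha, rfl⟩, b, hb, rfl⟩ := Submodule.mem_sup.mp hx
      rw [mul_add]
      refine Submodule.add_mem_sup ⟨z * a, hG.mul_mem_succ hz ha, ?_⟩ (hJmul _ z hz b hb)
      simp only [LinearMap.mulLeft_apply]; ring
    rw [← hrank (m + 1), h2]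
  have hstat' : ∀ m, Module.finrank k (G m) + Module.finrank k (J (m + 1)) =
      Module.finrank k (G (m + 1)) + Module.finrank k (J m) → ∀ i,
      Module.finrank k (G (m + i)) + Module.finrank k (J (m + i + 1)) =
      Module.finrank k (G (m + i + 1)) + Module.finrank k (J (m + i)) := by
    intro m h i
    induction i with
    | zero => exact h
    | succ i ih => exact hstat _ ih
  have hconst : ∀ m, Module.finrank k (G m) + Module.finrank k (J (m + 1)) =
      Module.finrank k (G (m + 1)) + Module.finrank k (J m) → ∀ i,
      Module.finrank k (G (m + i)) + Module.finrank k (J m) =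
      Module.finrank k (G m) + Module.finrank k (J (m + i)) := by
    intro m h i
    induction i with
    | zero => exact add_comm _ _ |>.trans (add_comm _ _)
    | succ i ih => have := hstat' m h i; rw [← add_assoc]; omega
  have hJlow : ∀ m, Module.finrank k (G m) ≤ Module.finrank k (J (m + 1)) := fun m => by
    rw [← hmapfin hl0 (G m)]; exact Submodule.finrank_mono (hlJ m)
  have hJeq : ∀ m ≥ N, Module.finrank k (J (m + 1)) = (n + 1) * m := fun m hm => by
    rw [← hN m hm, ← hmapfin hl0 (G m)]
    exact le_antisymm (Submodule.finrank_mono (hJbig m hm)) (Submodule.finrank_mono (hlJ m))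
  have hstep : ∀ m, Module.finrank k (G m) < Module.finrank k (J m) + (n + 1) →
      Module.finrank k (G m) + Module.finrank k (J (m + 1)) + 1 ≤
      Module.finrank k (G (m + 1)) + Module.finrank k (J m) := by
    intro m h
    by_contra h'
    have h1 := hconst m (by have := hmono m; omega) (N + 1)
    have h2 := hJeq (m + N) (by omega)
    have h3 := hN (m + N + 1) (by omega)
    rw [← add_assoc] at h1
    rw [h2, h3] at h1
    have : (n + 1) * (m + N + 1) = (n + 1) * (m + N) + (n + 1) := by ring
    omega
  have hb2 : Module.finrank k (J 2) + n ≤ Module.finrank k (G 2) := by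
    have h1 := hmono 1
    have h2 := hstep 1
    rw [show (1 + 1 : ℕ) = 2 from rfl] at h1 h2
    omega
  have hb : ∀ i, Module.finrank k (J (i + 3)) + (n + 1) ≤ Module.finrank k (G (i + 3)) := by
    intro i
    induction i with
    | zero =>
      have h1 := hmono 2
      have h2 := hstep 2
      rw [show (2 + 1 : ℕ) = 3 from rfl] at h1 h2
      rw [show (0 + 3 : ℕ) = 3 from rfl]
      omega
    | succ i ih =>
      have h1 := hmono (i + 3)
      rw [show i + 1 + 3 = i + 3 + 1 by omega]
      omega
  have hgrow : ∀ i, Module.finrank k (G 2) + (n + 1) * i ≤ Module.finrank k (G (i + 2)) := by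
    intro i
    induction i with
    | zero => simp
    | succ i ih =>
      have h1 := hb i
      have h2 := hJlow (i + 2)
      have : (n + 1) * (i + 1) = (n + 1) * i + (n + 1) := by ring
      rw [show i + 1 + 2 = i + 3 by omega]
      rw [show i + 2 + 1 = i + 3 by omega] at h2
      omega
  have h1 := hgrow N
  rw [hN (N + 2) (by omega)] at h1
  nlinarith

end StdGrading

theorem finrank_map_add_finrank_inf_ker {k V W : Type*} [Field k] [AddCommGroup V] [Module k V]
    [AddCommGroup W] [Module k W] (g : V →ₗ[k] W) (P : Submodule k V) [FiniteDimensional k P] :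
    Module.finrank k (P.map g) + Module.finrank k ↥(P ⊓ LinearMap.ker g) = Module.finrank k P := by
  have h := LinearMap.finrank_range_add_finrank_ker (g.domRestrict P)
  have e1 : LinearMap.range (g.domRestrict P) = P.map g := by
    ext x; simp
  have e2 : (LinearMap.ker (g.domRestrict P)).map P.subtype = P ⊓ LinearMap.ker g := by
    ext x
    simp only [Submodule.mem_map, LinearMap.mem_ker, LinearMap.domRestrict_apply,
      Submodule.mem_inf, Submodule.subtype_apply]
    exact ⟨fun ⟨y, hy, e⟩ => e ▸ ⟨y.2, hy⟩, fun ⟨h1, h2⟩ => ⟨⟨x, h1⟩, h2, rfl⟩⟩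
  have e3 := LinearEquiv.finrank_eq (Submodule.equivMapOfInjective P.subtype
    P.injective_subtype (LinearMap.ker (g.domRestrict P)))
  rw [e2] at e3
  rw [← h, e1, e3]

section Forms

variable {k : Type} [Field k] {ι : Type} [Fintype ι] [DecidableEq ι]

/-- The linear form attached to an element of the dual space. -/
def linForm : Module.Dual k (ι → k) →ₗ[k] MvPolynomial ι k where
  toFun φ := ∑ i, C (φ (Pi.single i 1)) * X i
  map_add' φ ψ := by simp [add_mul, Finset.sum_add_distrib]
  map_smul' c φ := by simp [Finset.smul_sum, smul_eq_C_mul, mul_assoc]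

theorem eval_linForm (φ : Module.Dual k (ι → k)) (v : ι → k) : eval v (linForm φ) = φ v := by
  conv_rhs => rw [pi_eq_sum_univ' v, map_sum]
  simp [linForm, mul_comm]

theorem linForm_mem (φ : Module.Dual k (ι → k)) : linForm φ ∈ homogeneousSubmodule ι k 1 := by
  refine Submodule.sum_mem _ fun i _ => ?_
  rw [← smul_eq_C_mul]
  exact Submodule.smul_mem _ _ (isHomogeneous_X k i)

theorem exists_linForm_eq {f : MvPolynomial ι k} (hf : f ∈ homogeneousSubmodule ι k 1) :
    ∃ φ : Module.Dual k (ι → k), linForm φ = f := by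
  rw [homogeneousSubmodule_one_eq_span_X] at hf
  change f ∈ LinearMap.range (linForm (k := k) (ι := ι))
  revert f
  rw [← SetLike.le_def, Submodule.span_le]
  rintro _ ⟨i, rfl⟩
  refine ⟨LinearMap.proj i, ?_⟩
  simp [linForm, Pi.single_apply]

theorem homogeneousComponent_succ_mul {f l : MvPolynomial ι k} (hl : l ∈ homogeneousSubmodule ι k 1)
    (m : ℕ) : homogeneousComponent (m + 1) (f * l) = homogeneousComponent m f * l := by
  conv_lhs => rw [← sum_homogeneousComponent f, Finset.sum_mul, map_sum]
  have h : ∀ i, homogeneousComponent (m + 1) (homogeneousComponent i f * l) =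
      if i = m then homogeneousComponent m f * l else 0 := by
    intro i
    have h1 : homogeneousComponent i f * l ∈ homogeneousSubmodule ι k (i + 1) :=
      (homogeneousComponent_isHomogeneous i f).mul hl
    rw [homogeneousComponent_of_mem h1]
    by_cases h : i = m
    · simp [h]
    · simp [h, Ne.symm h]
  simp_rw [h]
  rw [Finset.sum_ite_eq']
  split_ifs with h
  · rfl
  · rw [homogeneousComponent_eq_zero, zero_mul]
    simp at h; omega

theorem mem_vanIdeal {Y : Set (ι → k)} {f : MvPolynomial ι k} :
    f ∈ vanIdeal k ι Y ↔ ∀ x ∈ Y, eval x f = 0 := by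
  simp [vanIdeal, Submodule.mem_iInf, RingHom.mem_ker]

theorem eval_smul_of_isHomogeneous {f : MvPolynomial ι k} {m : ℕ} (hf : f.IsHomogeneous m)
    (t : k) (x : ι → k) : eval (t • x) f = t ^ m * eval x f := by
  rw [eval_eq, eval_eq, Finset.mul_sum]
  refine Finset.sum_congr rfl fun d hd => ?_
  have hd' : ∑ i, d i = m := by
    have := hf (mem_support_iff.mp hd)
    rw [← this, Finsupp.weight_apply, Finsupp.sum_fintype] <;> simp
  simp only [Pi.smul_apply, smul_eq_mul, mul_pow, Finset.prod_mul_distrib]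
  have : ∏ i ∈ d.support, t ^ d i = t ^ m := by
    rw [Finset.prod_pow_eq_pow_sum, ← hd']
    congr 1
    exact Finset.sum_subset (Finset.subset_univ _) (by simp)
  rw [this]; ring

theorem homogeneousComponent_mem_vanIdeal [Infinite k] {Y : Set (ι → k)}
    (hY : ∀ x ∈ Y, ∀ t : k, t • x ∈ Y) {f : MvPolynomial ι k} (hf : f ∈ vanIdeal k ι Y) (m : ℕ) :
    homogeneousComponent m f ∈ vanIdeal k ι Y := by
  rw [mem_vanIdeal] at hf ⊢
  intro x hx
  let p : Polynomial k := ∑ i ∈ Finset.range (f.totalDegree + 1),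
    Polynomial.monomial i (eval x (homogeneousComponent i f))
  have hp : p = 0 := by
    apply Polynomial.funext
    intro t
    have h1 := hf _ (hY x hx t)
    conv_lhs at h1 => rw [← sum_homogeneousComponent f, map_sum]
    rw [Polynomial.eval_zero, ← h1, Polynomial.eval_finsetSum]
    refine Finset.sum_congr rfl fun i _ => ?_
    rw [Polynomial.eval_monomial,
      eval_smul_of_isHomogeneous (homogeneousComponent_isHomogeneous i f), mul_comm]
  by_cases hm : m ≤ f.totalDegree
  · have h2 : p.coeff m = 0 := by rw [hp]; simp
    simp only [p, Polynomial.finsetSum_coeff, Polynomial.coeff_monomial, Finset.sum_ite_eq'] at h2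
    simpa [Nat.lt_succ_iff, hm] using h2
  · rw [homogeneousComponent_eq_zero _ _ (by omega), map_zero]

end Forms

section CoordRing

variable {k : Type} [Field k] {ι : Type} [Fintype ι] [DecidableEq ι]

/-- The quotient map to the coordinate ring, as a linear map. -/
def toCoord (Y : Set (ι → k)) : MvPolynomial ι k →ₗ[k] MvPolynomial ι k ⧸ vanIdeal k ι Y :=
  (Ideal.Quotient.mkₐ k (vanIdeal k ι Y)).toLinearMap

theorem toCoord_mul (Y : Set (ι → k)) (f g : MvPolynomial ι k) :
    toCoord Y (f * g) = toCoord Y f * toCoord Y g := map_mul (Ideal.Quotient.mkₐ k _) f g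

theorem toCoord_eq_zero {Y : Set (ι → k)} {f : MvPolynomial ι k} :
    toCoord Y f = 0 ↔ f ∈ vanIdeal k ι Y := Ideal.Quotient.eq_zero_iff_mem

theorem toCoord_eq {Y : Set (ι → k)} {f g : MvPolynomial ι k} :
    toCoord Y f = toCoord Y g ↔ f - g ∈ vanIdeal k ι Y := Ideal.Quotient.eq

/-- The graded pieces of the coordinate ring. -/
def coordPiece (Y : Set (ι → k)) (m : ℕ) : Submodule k (MvPolynomial ι k ⧸ vanIdeal k ι Y) :=
  (homogeneousSubmodule ι k m).map (toCoord Y)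

theorem toCoord_mem {Y : Set (ι → k)} {m : ℕ} {f : MvPolynomial ι k}
    (hf : f ∈ homogeneousSubmodule ι k m) : toCoord Y f ∈ coordPiece Y m := ⟨f, hf, rfl⟩

instance finiteDimensional_homogeneousSubmodule (m : ℕ) :
    FiniteDimensional k (homogeneousSubmodule ι k m) :=
  Module.Finite.iff_fg.mpr (homogeneousSubmodule_fg ι k m)

theorem stdGrading_coordPiece (Y : Set (ι → k)) : StdGrading k (coordPiece Y) where
  fd m := by unfold coordPiece; infer_instance
  mul_mem := by
    rintro a b _ ⟨x, hx, rfl⟩ _ ⟨y, hy, rfl⟩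
    rw [← toCoord_mul]
    exact toCoord_mem (IsHomogeneous.mul hx hy)
  gen m := by
    have h : homogeneousSubmodule ι k (m + 1)
        = homogeneousSubmodule ι k 1 * homogeneousSubmodule ι k m := by
      rw [← homogeneousSubmodule_one_pow k (m + 1), pow_succ', homogeneousSubmodule_one_pow]
    unfold coordPiece
    rw [h]
    exact (Submodule.map_mul _ _ (Ideal.Quotient.mkₐ k (vanIdeal k ι Y))).le

theorem inf_ker_toCoord (Y : Set (ι → k)) (m : ℕ) :
    homogeneousSubmodule ι k m ⊓ LinearMap.ker (toCoord Y) = idealPiece k ι (vanIdeal k ι Y) m := by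
  ext f
  simp only [idealPiece, Submodule.mem_inf, LinearMap.mem_ker, toCoord_eq_zero,
    Submodule.restrictScalars_mem, and_comm]

theorem finrank_coordPiece_add (Y : Set (ι → k)) (m : ℕ) :
    Module.finrank k (coordPiece Y m) + Module.finrank k (idealPiece k ι (vanIdeal k ι Y) m) =
      Module.finrank k (homogeneousSubmodule ι k m) := by
  rw [← inf_ker_toCoord]
  exact finrank_map_add_finrank_inf_ker _ _

theorem finrank_coordPiece (Y : Set (ι → k)) (m : ℕ) :
    Module.finrank k (coordPiece Y m) = hilb k ι Y m := by
  have := finrank_coordPiece_add Y m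
  unfold hilb idealHilb
  omega

theorem linForm_eq_zero_of_nondeg {Y : Set (ι → k)} (hY : Nondeg k ι Y)
    {φ : Module.Dual k (ι → k)} (h : ∀ y ∈ Y, φ y = 0) : φ = 0 := by
  have h1 := hY (linForm φ) (linForm_mem φ) (fun x hx => by rw [eval_linForm, h x hx])
  ext v
  simp [← eval_linForm φ, h1]

theorem toCoord_linForm_ne_zero {Y : Set (ι → k)} (hY : Nondeg k ι Y)
    {φ : Module.Dual k (ι → k)} (h : φ ≠ 0) : toCoord Y (linForm φ) ≠ 0 := by
  intro h'
  rw [toCoord_eq_zero, mem_vanIdeal] at h'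
  exact h (linForm_eq_zero_of_nondeg hY fun y hy => by rw [← eval_linForm, h' y hy])

theorem finrank_coordPiece_one {Y : Set (ι → k)} (hY : Nondeg k ι Y) :
    Module.finrank k (coordPiece Y 1) = Fintype.card ι := by
  have h : coordPiece Y 1 = LinearMap.range (toCoord Y ∘ₗ linForm) := by
    ext r
    constructor
    · rintro ⟨f, hf, rfl⟩
      obtain ⟨φ, rfl⟩ := exists_linForm_eq hf
      exact ⟨φ, rfl⟩
    · rintro ⟨φ, rfl⟩
      exact toCoord_mem (linForm_mem φ)
  rw [h, LinearMap.finrank_range_of_inj, Subspace.dual_finrank_eq, Module.finrank_fintype_fun_eq_card]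
  rw [← LinearMap.ker_eq_bot, LinearMap.ker_eq_bot']
  intro φ hφ
  by_contra h0
  exact toCoord_linForm_ne_zero hY h0 hφ

/-- Projective Nullstellensatz for a closed cone and linear forms without common zeros on it. -/
theorem exists_homogeneous_le_of_no_common_zero [IsAlgClosed k] {Y : Set (ι → k)}
    (hY : IsProjVariety k ι Y) (U : Submodule k (Module.Dual k (ι → k)))
    (hU : ∀ y ∈ Y, (∀ φ ∈ U, φ y = 0) → y = 0) :
    ∃ N, ∀ m ≥ N, ∀ f ∈ homogeneousSubmodule ι k (m + 1),
      ∃ g ∈ U.map linForm * homogeneousSubmodule ι k m, f - g ∈ vanIdeal k ι Y := by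
  have := Fintype.finite (α := ι) inferInstance
  set K : Ideal (MvPolynomial ι k) := vanIdeal k ι Y ⊔ Ideal.span (U.map linForm : Set (MvPolynomial ι k))
  have hrad : idealOfVars ι k ≤ K.radical := by
    rw [← vanishingIdeal_zeroLocus_eq_radical (K := k), idealOfVars, Ideal.span_le]
    rintro _ ⟨i, rfl⟩
    rw [SetLike.mem_coe, mem_vanishingIdeal_iff]
    intro x hx
    rw [mem_zeroLocus_iff] at hx
    have hxY : x ∈ Y := by
      rw [hY.closed]
      exact fun f hf => hx f (Ideal.mem_sup_left hf)
    have : x = 0 := by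
      apply hU x hxY
      intro φ hφ
      rw [← eval_linForm]
      exact hx _ (Ideal.mem_sup_right (Ideal.subset_span ⟨φ, hφ, rfl⟩))
    simp [this]
  obtain ⟨N, hN⟩ := Ideal.exists_pow_le_of_le_radical_of_fg hrad (idealOfVars_fg ι k)
  refine ⟨N, fun m hm f hf => ?_⟩
  have hf1 : f ∈ K := by
    apply hN
    rw [mem_pow_idealOfVars_iff']
    intro d hd
    by_contra h
    have h1 := hf h
    have h2 : Finsupp.weight (1 : ι → ℕ) d = d.degree :=
      (DFunLike.congr_fun (Finsupp.degree_eq_weight_one (R := ℕ)) d).symm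
    omega
  obtain ⟨p, hp, q, hq, rfl⟩ := Submodule.mem_sup.mp hf1
  refine ⟨homogeneousComponent (m + 1) q, ?_, ?_⟩
  · have key : ∀ a, homogeneousComponent (m + 1) (a * q) ∈
        U.map linForm * homogeneousSubmodule ι k m := by
      clear hf1 hf hp
      induction hq using Submodule.span_induction with
      | mem x hx =>
        intro a
        obtain ⟨φ, hφ, rfl⟩ := hx
        rw [homogeneousComponent_succ_mul (linForm_mem φ), mul_comm _ (linForm φ)]
        exact Submodule.mul_mem_mul (Submodule.mem_map_of_mem hφ)
          (homogeneousComponent_isHomogeneous _ _)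
      | zero => simp
      | add x y _ _ hx hy =>
        intro a
        rw [mul_add, map_add]
        exact Submodule.add_mem _ (hx a) (hy a)
      | smul b x hx ih =>
        intro a
        rw [smul_eq_mul, ← mul_assoc]
        exact ih _
    simpa using key 1
  · have h1 := homogeneousComponent_of_mem (m := m + 1) hf
    rw [if_pos rfl] at h1
    nth_rw 1 [← h1]
    rw [map_add, add_sub_cancel_right]
    exact homogeneousComponent_mem_vanIdeal hY.smul_mem hp _

end CoordRing

section Sections

variable {k : Type} [Field k] {ι : Type} [Fintype ι] [DecidableEq ι]

/-- Evaluation of polynomials at a family of points. -/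
def evalAt {α : Type} (p : α → ι → k) : MvPolynomial ι k →ₗ[k] (α → k) where
  toFun f := fun a => eval (p a) f
  map_add' f g := by ext; simp
  map_smul' c f := by ext; simp

theorem finrank_map_toCoord_add_card_le {Y : Set (ι → k)} {m : ℕ} {α : Type} [Fintype α]
    (p : α → ι → k) (W : Submodule k (MvPolynomial ι k)) (hW : W ≤ homogeneousSubmodule ι k m)
    (hWp : ∀ f ∈ W, ∀ a, eval (p a) f = 0)
    (hIp : ∀ f ∈ idealPiece k ι (vanIdeal k ι Y) m, ∀ a, eval (p a) f = 0)
    (hsep : ∀ a, ∃ f ∈ homogeneousSubmodule ι k m, eval (p a) f ≠ 0 ∧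
      ∀ b ≠ a, eval (p b) f = 0) :
    Module.finrank k (W.map (toCoord Y)) + Fintype.card α ≤ Module.finrank k (coordPiece Y m) := by
  classical
  set I := idealPiece k ι (vanIdeal k ι Y) m with hI
  have hIS : I ≤ homogeneousSubmodule ι k m := inf_le_right
  have hWI : W ⊔ I ≤ homogeneousSubmodule ι k m := sup_le hW hIS
  have : FiniteDimensional k ↥(W ⊔ I) := Submodule.finiteDimensional_of_le hWI
  have h1 := finrank_map_add_finrank_inf_ker (toCoord Y) (W ⊔ I)
  have h2 : (W ⊔ I) ⊓ LinearMap.ker (toCoord Y) = I := by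
    apply le_antisymm
    · rw [hI, ← inf_ker_toCoord]
      exact inf_le_inf_right _ (by rw [inf_ker_toCoord]; exact hWI)
    · refine le_inf le_sup_right ?_
      rw [hI, ← inf_ker_toCoord]
      exact inf_le_right
  have h3 : Module.finrank k (W.map (toCoord Y)) ≤ Module.finrank k ((W ⊔ I).map (toCoord Y)) :=
    Submodule.finrank_mono (Submodule.map_mono le_sup_left)
  have h4 := finrank_map_add_finrank_inf_ker (evalAt p) (homogeneousSubmodule ι k m)
  have h5 : (homogeneousSubmodule ι k m).map (evalAt p) = ⊤ := by
    rw [eq_top_iff, ← (Pi.basisFun k α).span_eq, Submodule.span_le]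
    rintro _ ⟨a, rfl⟩
    obtain ⟨f, hf, hfa, hfb⟩ := hsep a
    refine ⟨(eval (p a) f)⁻¹ • f, Submodule.smul_mem _ _ hf, ?_⟩
    ext b
    by_cases hb : b = a
    · subst hb; simp [evalAt, hfa]
    · simp [evalAt, hfb b hb, hb]
  rw [h5, finrank_top, Module.finrank_fintype_fun_eq_card] at h4
  have : FiniteDimensional k ↥(homogeneousSubmodule ι k m ⊓ LinearMap.ker (evalAt p)) :=
    Submodule.finiteDimensional_inf_left _ _
  have h6 : Module.finrank k ↥(W ⊔ I) ≤
      Module.finrank k ↥(homogeneousSubmodule ι k m ⊓ LinearMap.ker (evalAt p)) := by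
    apply Submodule.finrank_mono
    refine le_inf hWI (sup_le ?_ ?_)
    · exact fun f hf => by ext a; exact hWp f hf a
    · exact fun f hf => by ext a; exact hIp f hf a
  have h7 := finrank_coordPiece_add Y m
  rw [← hI] at h7
  rw [h2] at h1
  omega

theorem exists_dual_ne_zero_of_notMem {V : Type*} [AddCommGroup V] [Module k V]
    {W : Submodule k V} {v : V} (hv : v ∉ W) : ∃ φ : Module.Dual k V, φ v ≠ 0 ∧ ∀ w ∈ W, φ w = 0 := by
  obtain ⟨φ, h1, h2⟩ := Submodule.exists_le_ker_of_notMem hv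
  exact ⟨φ, h1, fun w hw => h2 hw⟩

/-- A proper linear section of a curve consists of finitely many points. -/
theorem exists_finset_cover_hyperplane {Y : Set (ι → k)}
    [(vanIdeal k ι Y).IsPrime] (hnd : Nondeg k ι Y) {d : ℕ}
    (hh : ∀ᶠ m in Filter.atTop, Module.finrank k (coordPiece Y m) = d * m)
    {l : Module.Dual k (ι → k)} (hl : l ≠ 0) :
    ∃ F : Finset (ι → k), (∀ f ∈ F, f ∈ Y ∧ f ≠ 0) ∧
      ∀ y ∈ Y, l y = 0 → y ≠ 0 → ∃ f ∈ F, ∃ μ : k, y = μ • f := by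
  classical
  obtain ⟨M, hM⟩ := Filter.eventually_atTop.mp hh
  by_contra! hcon
  have hex : ∀ n, ∃ F : Finset (ι → k), F.card = n ∧ (∀ f ∈ F, f ∈ Y ∧ f ≠ 0 ∧ l f = 0) ∧
      ∀ f ∈ F, ∀ g ∈ F, f ≠ g → f ∉ Submodule.span k {g} := by
    intro n
    induction n with
    | zero => exact ⟨∅, by simp⟩
    | succ n ih =>
      obtain ⟨F, hFc, hF, hFF⟩ := ih
      obtain ⟨y, hyY, hly, hy0, hy⟩ := hcon F fun f hf => ⟨(hF f hf).1, (hF f hf).2.1⟩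
      have hyF : y ∉ F := fun h => hy y h 1 (by simp)
      refine ⟨insert y F, by rw [Finset.card_insert_of_notMem hyF, hFc], ?_, ?_⟩
      · intro f hf
        rcases Finset.mem_insert.mp hf with rfl | hf
        · exact ⟨hyY, hy0, hly⟩
        · exact hF f hf
      · intro f hf g hg hfg
        rw [Submodule.mem_span_singleton]
        rintro ⟨μ, e⟩
        rcases Finset.mem_insert.mp hf with rfl | hf' <;> rcases Finset.mem_insert.mp hg with rfl | hg'
        · exact hfg rfl
        · exact hy g hg' μ e.symm
        · have hμ : μ ≠ 0 := by
            rintro rfl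
            exact (hF f hf').2.1 (by rw [← e, zero_smul])
          exact hy f hf' μ⁻¹ (by rw [← e, smul_smul, inv_mul_cancel₀ hμ, one_smul])
        · exact hFF f hf' g hg' hfg (Submodule.mem_span_singleton.mpr ⟨μ, e⟩)
  obtain ⟨F, hFc, hF, hFF⟩ := hex (d + 1)
  set m := M + d + 1
  have hlR := toCoord_linForm_ne_zero hnd hl
  have key := finrank_map_toCoord_add_card_le (Y := Y) (m := m + 1) (α := F) (fun f => (f : ι → k))
    ((homogeneousSubmodule ι k m).map (LinearMap.mulLeft k (linForm l))) ?_ ?_ ?_ ?_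
  · have e1 : ((homogeneousSubmodule ι k m).map (LinearMap.mulLeft k (linForm l))).map (toCoord Y)
        = (coordPiece Y m).map (LinearMap.mulLeft k (toCoord Y (linForm l))) := by
      unfold coordPiece
      rw [← Submodule.map_comp, ← Submodule.map_comp]
      congr 1
    rw [e1, ← LinearEquiv.finrank_eq (Submodule.equivMapOfInjective _
      (mulLeft_injective_of_ne_zero hlR) (coordPiece Y m)), hM m (by omega), hM (m + 1) (by omega),
      Fintype.card_coe, hFc] at key
    nlinarith
  · rintro _ ⟨f, hf, rfl⟩
    rw [add_comm m 1]
    exact IsHomogeneous.mul (linForm_mem l) hf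
  · rintro _ ⟨f, hf, rfl⟩ a
    simp [eval_linForm, (hF a a.2).2.2]
  · intro f hf a
    exact mem_vanIdeal.mp hf.1 _ (hF a a.2).1
  · intro a
    have hφ : ∀ b ∈ F.erase a, ∃ φ : Module.Dual k (ι → k), φ a ≠ 0 ∧ φ b = 0 := by
      intro b hb
      obtain ⟨φ, h1, h2⟩ := exists_dual_ne_zero_of_notMem
        (hFF a a.2 b (Finset.mem_of_mem_erase hb) (Finset.ne_of_mem_erase hb).symm)
      exact ⟨φ, h1, h2 b (Submodule.mem_span_singleton_self b)⟩
    choose! φ hφa hφb using hφ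
    obtain ⟨ψ, hψ, -⟩ := exists_dual_ne_zero_of_notMem (k := k) (W := ⊥) (v := (a : ι → k))
      (by simpa using (hF a a.2).2.1)
    refine ⟨(∏ b ∈ F.erase a, linForm (φ b)) * linForm ψ ^ (M + 2), ?_, ?_, ?_⟩
    · have h1 := IsHomogeneous.prod (F.erase a) (fun b => linForm (φ b)) (fun _ => 1)
        fun b _ => linForm_mem (φ b)
      have h2 := IsHomogeneous.pow (linForm_mem ψ) (M + 2)
      have h3 := h1.mul h2
      have h4 : (∑ b ∈ F.erase (a : ι → k), 1) + 1 * (M + 2) = m + 1 := by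
        rw [← Finset.card_eq_sum_ones, Finset.card_erase_of_mem a.2, hFc]
        omega
      rwa [h4] at h3
    · rw [map_mul, map_prod, map_pow]
      simp only [eval_linForm]
      exact mul_ne_zero (Finset.prod_ne_zero_iff.mpr fun b hb => hφa b hb) (pow_ne_zero _ hψ)
    · intro b hb
      have hb' : (b : ι → k) ∈ F.erase a :=
        Finset.mem_erase.mpr ⟨fun h => hb (Subtype.ext h), b.2⟩
      rw [map_mul, map_prod, Finset.prod_eq_zero hb', zero_mul]
      rw [eval_linForm, hφb b hb']

/-- A base point free linear system contains a base point free pencil. -/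
theorem exists_pencil [Infinite k] {Y : Set (ι → k)}
    [(vanIdeal k ι Y).IsPrime] (hnd : Nondeg k ι Y) {d : ℕ}
    (hh : ∀ᶠ m in Filter.atTop, Module.finrank k (coordPiece Y m) = d * m)
    (U : Submodule k (Module.Dual k (ι → k))) (hU0 : U ≠ ⊥)
    (hU : ∀ y ∈ Y, (∀ φ ∈ U, φ y = 0) → y = 0) :
    ∃ φ ∈ U, ∃ ψ ∈ U, φ ≠ 0 ∧ ψ ≠ 0 ∧ ∀ y ∈ Y, φ y = 0 → ψ y = 0 → y = 0 := by
  classical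
  obtain ⟨φ, hφU, hφ⟩ := Submodule.exists_mem_ne_zero_of_ne_bot hU0
  obtain ⟨F, hF, hFc⟩ := exists_finset_cover_hyperplane hnd hh hφ
  let ev : (ι → k) → Submodule k U := fun f =>
    LinearMap.ker ((LinearMap.applyₗ (R := k) f).comp U.subtype)
  have hev : ∀ f (u : U), u ∈ ev f ↔ (u : Module.Dual k (ι → k)) f = 0 := fun f u => by simp [ev]
  have : Nontrivial U := Submodule.nontrivial_iff_ne_bot.mpr hU0
  have hcov := Subspace.biUnion_ne_univ_of_top_notMem (k := k) (E := U)
    (s := insert ⊥ (F.image ev)) (by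
      rw [Finset.mem_insert, not_or]
      refine ⟨top_ne_bot, ?_⟩
      rw [Finset.mem_image]
      rintro ⟨f, hf, e⟩
      refine (hF f hf).2 (hU f (hF f hf).1 fun φ hφ => ?_)
      have : (⟨φ, hφ⟩ : U) ∈ ev f := by rw [e]; trivial
      exact (hev _ _).mp this)
  obtain ⟨ψ, hψ⟩ := (Set.ne_univ_iff_exists_notMem _).mp hcov
  simp only [Set.mem_iUnion, not_exists, SetLike.mem_coe] at hψ
  refine ⟨φ, hφU, ψ, ψ.2, hφ, ?_, ?_⟩
  · intro h
    exact hψ ⊥ (Finset.mem_insert_self _ _) (by simpa using h)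
  · intro y hy h1 h2
    by_contra hy0
    obtain ⟨f, hf, μ, rfl⟩ := hFc y hy h1 hy0
    refine hψ (ev f) (Finset.mem_insert_of_mem (Finset.mem_image_of_mem _ hf)) ((hev _ _).mpr ?_)
    rw [map_smul, smul_eq_mul] at h2
    rcases mul_eq_zero.mp h2 with h | h
    · exact absurd (by rw [h, zero_smul]) hy0
    · exact h

theorem coordPiece_eq_of_pencil [IsAlgClosed k] {Y : Set (ι → k)} (hY : IsProjVariety k ι Y)
    {φ ψ : Module.Dual k (ι → k)} (h : ∀ y ∈ Y, φ y = 0 → ψ y = 0 → y = 0) :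
    ∃ N, ∀ m ≥ N, ∀ r ∈ coordPiece Y (m + 1), ∃ u ∈ coordPiece Y m, ∃ v ∈ coordPiece Y m,
      r = toCoord Y (linForm φ) * u + toCoord Y (linForm ψ) * v := by
  obtain ⟨N, hN⟩ := exists_homogeneous_le_of_no_common_zero hY (Submodule.span k {φ, ψ})
    (fun y hy h' => h y hy (h' φ (Submodule.subset_span (by simp)))
      (h' ψ (Submodule.subset_span (by simp))))
  refine ⟨N, fun m hm r hr => ?_⟩
  obtain ⟨f, hf, rfl⟩ := hr
  obtain ⟨g, hg, hfg⟩ := hN m hm f hf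
  rw [toCoord_eq.mpr hfg]
  clear hfg
  induction hg using Submodule.mul_induction_on' with
  | mem_mul_mem a ha b hb =>
    obtain ⟨χ, hχ, rfl⟩ := ha
    obtain ⟨s, t, rfl⟩ := Submodule.mem_span_pair.mp hχ
    refine ⟨s • toCoord Y b, Submodule.smul_mem _ _ (toCoord_mem hb),
      t • toCoord Y b, Submodule.smul_mem _ _ (toCoord_mem hb), ?_⟩
    rw [toCoord_mul, map_add, map_smul, map_smul, map_add, map_smul, map_smul, add_mul,
      smul_mul_assoc, smul_mul_assoc, mul_smul_comm, mul_smul_comm]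
  | add x _ y _ hx hy =>
    obtain ⟨u, hu, v, hv, e⟩ := hx
    obtain ⟨u', hu', v', hv', e'⟩ := hy
    refine ⟨u + u', Submodule.add_mem _ hu hu', v + v', Submodule.add_mem _ hv hv', ?_⟩
    rw [map_add, e, e']; ring

end Sections

section Quadrics

variable {k : Type} [Field k] {ι : Type} [Fintype ι] [DecidableEq ι]

theorem finrank_homogeneousSubmodule_two :
    Module.finrank k (homogeneousSubmodule ι k 2) = (Fintype.card ι + 1).choose 2 := by
  have h : {d : ι →₀ ℕ | d.degree = 2} = ((Finset.univ : Finset ι).finsuppAntidiag 2 : Set (ι →₀ ℕ)) := by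
    ext d
    simp [Finset.mem_finsuppAntidiag, Finsupp.degree_eq_sum]
  rw [homogeneousSubmodule_eq_finsupp_supported, h,
    LinearEquiv.finrank_eq (AddMonoidAlgebra.supportedEquivFinsupp _), Module.finrank_finsupp_self]
  simp [Finset.card_finsuppAntidiag_nat_eq_choose]

theorem finrank_coordPiece_two_le [IsAlgClosed k] {Y : Set (ι → k)} (hY : IsProjVariety k ι Y)
    (hnd : Nondeg k ι Y) (hι : 0 < Fintype.card ι)
    (hh : ∀ᶠ m in Filter.atTop, Module.finrank k (coordPiece Y m) = (Fintype.card ι + 1) * m) :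
    Module.finrank k (coordPiece Y 2) ≤ 2 * (Fintype.card ι + 1) := by
  have := hY.prime
  have : Nonempty ι := Fintype.card_pos_iff.mp hι
  obtain ⟨φ, -, ψ, -, hφ, hψ, h⟩ := exists_pencil hnd hh ⊤ top_ne_bot (by
    intro y _ h
    by_contra hy
    obtain ⟨φ, hφ, -⟩ := exists_dual_ne_zero_of_notMem (k := k) (W := ⊥) (v := y) (by simpa using hy)
    exact hφ (h φ trivial))
  obtain ⟨N, hN⟩ := coordPiece_eq_of_pencil hY h
  obtain ⟨M, hM⟩ := Filter.eventually_atTop.mp hh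
  exact (stdGrading_coordPiece Y).finrank_two_le (N := max M N)
    (toCoord_mem (linForm_mem φ)) (toCoord_mem (linForm_mem ψ))
    (toCoord_linForm_ne_zero hnd hφ) (toCoord_linForm_ne_zero hnd hψ)
    (fun m hm => hN m (le_trans (le_max_right _ _) hm))
    (fun m hm => hM m (le_trans (le_max_left _ _) hm)) (finrank_coordPiece_one hnd)

theorem le_finrank_quadrics [IsAlgClosed k] {Y : Set (ι → k)} (hY : IsProjVariety k ι Y)
    (hnd : Nondeg k ι Y) (hι : 0 < Fintype.card ι)
    (hh : ∀ᶠ m in Filter.atTop, Module.finrank k (coordPiece Y m) = (Fintype.card ι + 1) * m) :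
    (Fintype.card ι + 1).choose 2 ≤
      Module.finrank k (quadrics k ι Y) + 2 * (Fintype.card ι + 1) := by
  have h1 := finrank_coordPiece_two_le hY hnd hι hh
  have h2 := finrank_coordPiece_add Y 2
  rw [finrank_homogeneousSubmodule_two] at h2
  unfold quadrics
  omega

/-- No four independent points of the base locus of the quadrics through the curve span
a space disjoint from the curve. -/
theorem not_four_points [IsAlgClosed k] {Y : Set (ι → k)} (hY : IsProjVariety k ι Y)
    (hnd : Nondeg k ι Y) (hι : 4 < Fintype.card ι)
    (hh : ∀ᶠ m in Filter.atTop, Module.finrank k (coordPiece Y m) = (Fintype.card ι + 1) * m)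
    {α : Type} [Fintype α] (hα : Fintype.card α = 4)
    (z : α → ι → k) (hz : LinearIndependent k z)
    (hq : ∀ f ∈ quadrics k ι Y, ∀ i, eval (z i) f = 0)
    (hsp : ∀ y ∈ Y, y ∈ Submodule.span k (Set.range z) → y = 0) : False := by
  have := hY.prime
  set Λ := Submodule.span k (Set.range z) with hΛ
  have hzΛ : ∀ i, z i ∈ Λ := fun i => Submodule.subset_span ⟨i, rfl⟩
  have hU0 : Λ.dualAnnihilator ≠ ⊥ := by
    intro h
    have h1 := Subspace.finrank_add_finrank_dualAnnihilator_eq Λ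
    have h2 : Module.finrank k Λ = 4 := by rw [hΛ, finrank_span_eq_card hz, hα]
    rw [h, h2, finrank_bot, Module.finrank_fintype_fun_eq_card] at h1
    omega
  obtain ⟨φ, hφU, ψ, hψU, hφ, hψ, h⟩ := exists_pencil hnd hh Λ.dualAnnihilator hU0 (by
    intro y hy h
    apply hsp y hy
    by_contra hy
    obtain ⟨φ, hφ, h2⟩ := exists_dual_ne_zero_of_notMem hy
    exact hφ (h φ ((Submodule.mem_dualAnnihilator φ).mpr h2)))
  have hφz : ∀ i, φ (z i) = 0 := fun i => (Submodule.mem_dualAnnihilator φ).mp hφU _ (hzΛ i)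
  have hψz : ∀ i, ψ (z i) = 0 := fun i => (Submodule.mem_dualAnnihilator ψ).mp hψU _ (hzΛ i)
  obtain ⟨N, hN⟩ := coordPiece_eq_of_pencil hY h
  obtain ⟨M, hM⟩ := Filter.eventually_atTop.mp hh
  have hfd := (stdGrading_coordPiece Y).fd
  have hpen := two_mul_finrank_le_of_pencil (k := k) (x := toCoord Y (linForm φ))
    (toCoord_linForm_ne_zero hnd hψ) (coordPiece Y 1) (coordPiece Y (max M N + 1))
    (coordPiece Y (max M N)) (by
      intro h
      have := hM (max M N + 1) (by omega)
      rw [h] at this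
      simp at this) (hN _ (le_max_right _ _))
    (fun a ha u hu => (stdGrading_coordPiece Y).mul_mem_succ ha hu)
  have key := finrank_map_toCoord_add_card_le (Y := Y) (m := 2) z
    ((homogeneousSubmodule ι k 1).map (LinearMap.mulLeft k (linForm φ)) ⊔
      (homogeneousSubmodule ι k 1).map (LinearMap.mulLeft k (linForm ψ))) ?_ ?_ hq ?_
  · have e1 : ∀ χ : Module.Dual k (ι → k),
        ((homogeneousSubmodule ι k 1).map (LinearMap.mulLeft k (linForm χ))).map (toCoord Y)
        = (coordPiece Y 1).map (LinearMap.mulLeft k (toCoord Y (linForm χ))) := by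
      intro χ
      unfold coordPiece
      rw [← Submodule.map_comp, ← Submodule.map_comp]
      congr 1
    rw [Submodule.map_sup, e1, e1, hα] at key
    rw [finrank_coordPiece_one hnd] at hpen
    have := finrank_coordPiece_two_le hY hnd (by omega) hh
    omega
  · refine sup_le ?_ ?_
    · rintro _ ⟨f, hf, rfl⟩
      exact IsHomogeneous.mul (linForm_mem φ) hf
    · rintro _ ⟨f, hf, rfl⟩
      exact IsHomogeneous.mul (linForm_mem ψ) hf
  · intro f hf a
    obtain ⟨_, ⟨g, -, rfl⟩, _, ⟨g', -, rfl⟩, rfl⟩ := Submodule.mem_sup.mp hf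
    simp [eval_linForm, hφz, hψz]
  · intro a
    obtain ⟨χ, hχ, hχ'⟩ := exists_dual_ne_zero_of_notMem (k := k)
      (W := Submodule.span k (z '' {a}ᶜ)) (v := z a)
      (hz.notMem_span_image (by simp))
    refine ⟨linForm χ ^ 2, IsHomogeneous.pow (linForm_mem χ) 2, ?_, ?_⟩
    · rw [map_pow, eval_linForm]; exact pow_ne_zero _ hχ
    · intro b hb
      rw [map_pow, eval_linForm, hχ' _ (Submodule.subset_span ⟨b, hb, rfl⟩), zero_pow two_ne_zero]

end Quadrics

section Position

variable {k : Type} [Field k] {ι : Type} [Fintype ι] [DecidableEq ι]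

/-- Zariski closed subsets of affine space. -/
def IsZariskiClosed (X : Set (ι → k)) : Prop :=
  ∀ w ∉ X, ∃ f : MvPolynomial ι k, (∀ x ∈ X, eval x f = 0) ∧ eval w f ≠ 0

theorem isZariskiClosed_submodule (W : Submodule k (ι → k)) :
    IsZariskiClosed (W : Set (ι → k)) := by
  intro w hw
  obtain ⟨φ, h1, h2⟩ := exists_dual_ne_zero_of_notMem hw
  exact ⟨linForm φ, fun x hx => by rw [eval_linForm, h2 x hx], by rwa [eval_linForm]⟩

/-- The join of a linear space and a disjoint projective variety is closed. -/
theorem isZariskiClosed_join [IsAlgClosed k] {Y : Set (ι → k)} (hY : IsProjVariety k ι Y)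
    (hnd : Nondeg k ι Y) (Λ : Submodule k (ι → k)) (hΛ : ∀ y ∈ Y, y ∈ Λ → y = 0) :
    IsZariskiClosed {x | ∃ v ∈ Λ, ∃ y ∈ Y, x = v + y} := by
  intro w hw
  simp only [Set.mem_ofPred_eq, not_exists, not_and] at hw
  have := hY.prime
  have hwΛ : w ∉ Λ := fun h => hw w h 0 hY.zero_mem (by simp)
  obtain ⟨φ, hφ, hφΛ⟩ := exists_dual_ne_zero_of_notMem hwΛ
  set Λ' := Λ ⊔ Submodule.span k {w}
  have hΛ' : ∀ y ∈ Y, y ∈ Λ' → y = 0 := by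
    intro y hy hy'
    obtain ⟨v, hv, u, hu, rfl⟩ := Submodule.mem_sup.mp hy'
    obtain ⟨t, rfl⟩ := Submodule.mem_span_singleton.mp hu
    by_cases ht : t = 0
    · subst ht
      exact hΛ _ hy (by simpa using hv)
    · refine absurd ?_ (hw (-(t⁻¹ • v)) (Submodule.neg_mem _ (Submodule.smul_mem _ _ hv)) _
        (hY.smul_mem _ hy t⁻¹))
      rw [smul_add, smul_smul, inv_mul_cancel₀ ht, one_smul]
      abel
  obtain ⟨N, hN⟩ := exists_homogeneous_le_of_no_common_zero hY Λ'.dualAnnihilator (by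
    intro y hy h
    apply hΛ' y hy
    by_contra hy
    obtain ⟨φ, hφ, h2⟩ := exists_dual_ne_zero_of_notMem hy
    exact hφ (h φ ((Submodule.mem_dualAnnihilator φ).mpr h2)))
  let b := Module.finBasis k (homogeneousSubmodule ι k N)
  have hex : ∀ i, ∃ u : Fin _ → Module.Dual k (ι → k), (∀ j, u j ∈ Λ'.dualAnnihilator) ∧
      linForm φ * (b i : MvPolynomial ι k) - ∑ j, linForm (u j) * (b j : MvPolynomial ι k)
        ∈ vanIdeal k ι Y := by
    intro i
    obtain ⟨g, hg, hgI⟩ := hN N le_rfl (linForm φ * (b i : MvPolynomial ι k)) (by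
      rw [add_comm]; exact IsHomogeneous.mul (linForm_mem φ) (b i).2)
    suffices H : ∃ u : Fin _ → Module.Dual k (ι → k), (∀ j, u j ∈ Λ'.dualAnnihilator) ∧
        g = ∑ j, linForm (u j) * (b j : MvPolynomial ι k) by
      obtain ⟨u, hu, rfl⟩ := H
      exact ⟨u, hu, hgI⟩
    clear hgI
    induction hg using Submodule.mul_induction_on' with
    | mem_mul_mem a ha c hc =>
      obtain ⟨χ, hχ, rfl⟩ := ha
      refine ⟨fun j => b.repr ⟨c, hc⟩ j • χ, fun j => Submodule.smul_mem _ _ hχ, ?_⟩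
      have h1 := congrArg Subtype.val (b.sum_repr ⟨c, hc⟩)
      simp only [AddSubmonoidClass.coe_finsetSum, SetLike.val_smul] at h1
      conv_lhs => rw [← h1]
      rw [Finset.mul_sum]
      refine Finset.sum_congr rfl fun j _ => ?_
      rw [map_smul, smul_mul_assoc, mul_smul_comm]
    | add x _ y _ hx hy =>
      obtain ⟨u, hu, rfl⟩ := hx
      obtain ⟨u', hu', rfl⟩ := hy
      refine ⟨fun j => u j + u' j, fun j => Submodule.add_mem _ (hu j) (hu' j), ?_⟩
      simp only [map_add, add_mul, Finset.sum_add_distrib]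
  choose u hu hub using hex
  let M : Matrix (Fin (Module.finrank k (homogeneousSubmodule ι k N)))
      (Fin (Module.finrank k (homogeneousSubmodule ι k N))) (MvPolynomial ι k) :=
    Matrix.of fun i j => (if i = j then linForm φ else 0) - linForm (u i j)
  have hdet : M.det ∈ vanIdeal k ι Y := by
    rw [← toCoord_eq_zero]
    change (Ideal.Quotient.mk (vanIdeal k ι Y)) M.det = 0
    rw [RingHom.map_det, ← Matrix.exists_mulVec_eq_zero_iff]
    refine ⟨fun i => Ideal.Quotient.mk _ (b i : MvPolynomial ι k), ?_, ?_⟩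
    · intro h0
      have hall : homogeneousSubmodule ι k N ≤ LinearMap.ker (toCoord Y) := by
        intro c hc
        have h1 := congrArg Subtype.val (b.sum_repr ⟨c, hc⟩)
        simp only [AddSubmonoidClass.coe_finsetSum, SetLike.val_smul] at h1
        rw [← h1]
        exact Submodule.sum_mem _ fun j _ => Submodule.smul_mem _ _ (congrFun h0 j)
      have h2 := hall (IsHomogeneous.pow (linForm_mem φ) N |> (by simpa using ·))
      rw [LinearMap.mem_ker, toCoord_eq_zero] at h2
      have h3 := hY.prime.mem_of_pow_mem N h2
      exact toCoord_linForm_ne_zero hnd (φ := φ) (fun h => hφ (by rw [h]; rfl))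
        (toCoord_eq_zero.mpr h3)
    · ext i
      have h1 : (Ideal.Quotient.mk (vanIdeal k ι Y)) (linForm φ * (b i : MvPolynomial ι k)
          - ∑ j, linForm (u i j) * (b j : MvPolynomial ι k)) = 0 :=
        Ideal.Quotient.eq_zero_iff_mem.mpr (hub i)
      rw [Pi.zero_apply, ← h1]
      simp only [Matrix.mulVec, dotProduct, RingHom.mapMatrix_apply, Matrix.map_apply, M,
        Matrix.of_apply]
      rw [map_sub, map_sum, map_mul]
      simp only [map_sub, sub_mul, Finset.sum_sub_distrib, map_mul]
      congr 1
      rw [Finset.sum_eq_single i]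
      · simp
      · intro j _ hj; simp [Ne.symm hj]
      · simp
  have hM : ∀ x, eval x M.det = (Matrix.of fun i j => (if i = j then φ x else 0) - u i j x).det := by
    intro x
    rw [RingHom.map_det]
    congr 1
    ext i j
    simp only [RingHom.mapMatrix_apply, Matrix.map_apply, M, Matrix.of_apply, map_sub, eval_linForm]
    split_ifs <;> simp [eval_linForm]
  refine ⟨M.det, ?_, ?_⟩
  · rintro _ ⟨v, hv, y, hy, rfl⟩
    rw [← mem_vanIdeal.mp hdet y hy, hM, hM]
    congr 1
    ext i j
    have h1 : u i j v = 0 := (Submodule.mem_dualAnnihilator _).mp (hu i j) v (Submodule.mem_sup_left hv)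
    simp [hφΛ v hv, h1]
  · rw [hM]
    have : (Matrix.of fun i j => (if i = j then φ w else 0) - u i j w) = Matrix.diagonal fun _ => φ w := by
      ext i j
      have h1 : u i j w = 0 := (Submodule.mem_dualAnnihilator _).mp (hu i j) w
        (Submodule.mem_sup_right (Submodule.mem_span_singleton_self w))
      simp [h1, Matrix.diagonal_apply]
    rw [this, Matrix.det_diagonal]
    exact Finset.prod_ne_zero_iff.mpr fun _ _ => hφ

/-- An irreducible set not contained in any of finitely many closed sets has a point outside them. -/
theorem exists_mem_forall_notMem {Z : Set (ι → k)} (hZ : (vanIdeal k ι Z).IsPrime) {α : Type*}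
    (s : Finset α) (X : α → Set (ι → k)) (hX : ∀ a ∈ s, IsZariskiClosed (X a))
    (hZX : ∀ a ∈ s, ∃ z ∈ Z, z ∉ X a) : ∃ z ∈ Z, ∀ a ∈ s, z ∉ X a := by
  have h : ∀ a ∈ s, ∃ f : MvPolynomial ι k, (∀ x ∈ X a, eval x f = 0) ∧ f ∉ vanIdeal k ι Z := by
    intro a ha
    obtain ⟨z, hz, hza⟩ := hZX a ha
    obtain ⟨f, h1, h2⟩ := hX a ha z hza
    exact ⟨f, h1, fun h => h2 (mem_vanIdeal.mp h z hz)⟩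
  choose! f hf hfZ using h
  have h1 : ∏ a ∈ s, f a ∉ vanIdeal k ι Z := by
    rw [hZ.prod_mem_iff]
    rintro ⟨a, ha, h⟩
    exact hfZ a ha h
  rw [mem_vanIdeal] at h1
  push Not at h1
  obtain ⟨z, hz, hz'⟩ := h1
  refine ⟨z, hz, fun a ha h => hz' ?_⟩
  rw [map_prod, Finset.prod_eq_zero ha (hf a ha z h)]

theorem exists_mem_notMem_submodule {Z : Set (ι → k)} (hZ : Nondeg k ι Z)
    {W : Submodule k (ι → k)} (hW : W ≠ ⊤) : ∃ z ∈ Z, z ∉ W := by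
  by_contra! h
  obtain ⟨v, hv⟩ : ∃ v, v ∉ W := by
    by_contra! h'
    exact hW (eq_top_iff.mpr fun x _ => h' x)
  obtain ⟨φ, h1, h2⟩ := exists_dual_ne_zero_of_notMem hv
  exact h1 (by rw [linForm_eq_zero_of_nondeg hZ fun z hz => h2 z (h z hz)]; rfl)

/-- Independent points of `Z` whose span is disjoint from `Y`. -/
structure FreeFrom (Y Z : Set (ι → k)) (Q : Finset ℕ) (z : ℕ → ι → k) : Prop where
  mem : ∀ i ∈ Q, z i ∈ Z
  indep : LinearIndepOn k z Q
  disj : ∀ y ∈ Y, y ∈ Submodule.span k (z '' Q) → y = (0 : ι → k)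

/-- Independent points of `Z`, any `t` of which span a space disjoint from `Y`. -/
structure GenPos (Y Z : Set (ι → k)) (t N : ℕ) (z : ℕ → ι → k) : Prop where
  mem : ∀ i < N, z i ∈ Z
  indep : LinearIndepOn k z (Finset.range N)
  disj : ∀ T ⊆ Finset.range N, T.card = t → ∀ y ∈ Y, y ∈ Submodule.span k (z '' T) → y = 0

theorem FreeFrom.exists_genPos {Y Z : Set (ι → k)} {Q : Finset ℕ} {z : ℕ → ι → k}
    (h : FreeFrom Y Z Q z) : ∃ z', GenPos Y Z Q.card Q.card z' := by
  let e : ℕ → ℕ := fun i => if h : i < Q.card then Q.orderEmbOfFin rfl ⟨i, h⟩ else 0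
  have he : ∀ i (h : i < Q.card), e i = Q.orderEmbOfFin rfl ⟨i, h⟩ := fun i h => dif_pos h
  have hQ : ∀ i < Q.card, e i ∈ Q := fun i hi => by rw [he i hi]; exact Q.orderEmbOfFin_mem rfl _
  have hinj : Set.InjOn e (Finset.range Q.card) := by
    intro i hi j hj hij
    simp only [Finset.coe_range, Set.mem_Iio] at hi hj
    rw [he i hi, he j hj] at hij
    simpa using (Q.orderEmbOfFin rfl).injective hij
  have himg : e '' (Finset.range Q.card) ⊆ Q := by
    rintro _ ⟨i, hi, rfl⟩
    exact hQ i (by simpa using hi)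
  refine ⟨z ∘ e, fun i hi => h.mem _ (hQ i hi), (h.indep.mono himg).comp_of_image hinj, ?_⟩
  intro T hT _ y hy hyT
  apply h.disj y hy
  refine Submodule.span_mono ?_ hyT
  rintro _ ⟨i, hi, rfl⟩
  exact ⟨e i, himg ⟨i, hT hi, rfl⟩, rfl⟩

theorem GenPos.exists_extend [IsAlgClosed k] {Y Z : Set (ι → k)} (hY : IsProjVariety k ι Y)
    (hYn : Nondeg k ι Y) (hZ : (vanIdeal k ι Z).IsPrime) (hZn : Nondeg k ι Z) {t N : ℕ}
    {z : ℕ → ι → k} (h : GenPos Y Z (t + 1) N z) (ht : t < N) (hN : N < Fintype.card ι)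
    (s : Finset (Submodule k (ι → k))) (hs : ⊤ ∉ s) :
    ∃ w, (∀ W ∈ s, w ∉ W) ∧ GenPos Y Z (t + 1) (N + 1) (Function.update z N w) := by
  classical
  have hTd : ∀ T ∈ (Finset.range N).powersetCard t, ∃ i < N, i ∉ T ∧
      ∀ y ∈ Y, y ∈ Submodule.span k (z '' (insert i T : Finset ℕ)) → y = 0 := by
    intro T hT
    rw [Finset.mem_powersetCard] at hT
    obtain ⟨i, hi, hiT⟩ := Finset.exists_mem_notMem_of_card_lt_card (s := T) (t := Finset.range N)
      (by simp [hT.2, ht])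
    refine ⟨i, by simpa using hi, hiT, h.disj _ ?_ ?_⟩
    · exact Finset.insert_subset hi hT.1
    · rw [Finset.card_insert_of_notMem hiT, hT.2]
  have hTd' : ∀ T ∈ (Finset.range N).powersetCard t, ∀ y ∈ Y,
      y ∈ Submodule.span k (z '' (T : Set ℕ)) → y = 0 := by
    intro T hT y hy hyT
    obtain ⟨i, -, -, hi⟩ := hTd T hT
    refine hi y hy (Submodule.span_mono (Set.image_mono ?_) hyT)
    simp
  let X : (Submodule k (ι → k)) ⊕ Finset ℕ → Set (ι → k) := Sum.elim (fun W => W)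
    (fun T => {x | ∃ v ∈ Submodule.span k (z '' (T : Set ℕ)), ∃ y ∈ Y, x = v + y})
  set A := Submodule.span k (z '' (Finset.range N : Set ℕ)) with hA
  have hAtop : A ≠ ⊤ := by
    intro hA'
    have h1 : Module.finrank k A ≤ N := by
      have := finrank_span_finset_le_card (R := k) ((Finset.range N).image z)
      rw [Finset.coe_image] at this
      exact this.trans (Finset.card_image_le.trans (by simp))
    rw [hA', finrank_top, Module.finrank_fintype_fun_eq_card] at h1
    omega
  obtain ⟨w, hwZ, hw⟩ := exists_mem_forall_notMem hZ
    ((insert A s).disjSum ((Finset.range N).powersetCard t)) X (by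
      rintro (W | T) ha
      · exact isZariskiClosed_submodule W
      · exact isZariskiClosed_join hY hYn _ (hTd' T (Finset.inr_mem_disjSum.mp ha))) (by
      rintro (W | T) ha
      · refine exists_mem_notMem_submodule hZn ?_
        rcases Finset.mem_insert.mp (Finset.inl_mem_disjSum.mp ha) with rfl | hW
        · exact hAtop
        · exact fun h => hs (h ▸ hW)
      · have hT := Finset.inr_mem_disjSum.mp ha
        obtain ⟨i, hiN, hiT, hi⟩ := hTd T hT
        refine ⟨z i, h.mem i hiN, ?_⟩
        rintro ⟨v, hv, y, hy, e⟩
        have h1 : y ∈ Submodule.span k (z '' (insert i T : Finset ℕ)) := by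
          rw [show y = z i - v by rw [e]; abel]
          refine Submodule.sub_mem _ (Submodule.subset_span ⟨i, by simp, rfl⟩)
            (Submodule.span_mono (Set.image_mono (by simp)) hv)
        rw [hi y hy h1, add_zero] at e
        rw [Finset.mem_powersetCard] at hT
        refine LinearIndepOn.notMem_span_of_insert (h.indep.mono (t := insert i (T : Set ℕ)) ?_)
          (by simpa using hiT) (e ▸ hv)
        exact Set.insert_subset (by simpa using hiN) (by exact_mod_cast hT.1))
  have hwA : w ∉ A := hw (Sum.inl A) (by simp)
  refine ⟨w, fun W hW => hw (Sum.inl W) (by simp [hW]), ?_⟩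
  have hup : ∀ i, i < N → Function.update z N w i = z i := fun i hi =>
    Function.update_of_ne (by omega) _ _
  have himg : ∀ T : Finset ℕ, T ⊆ Finset.range N →
      Function.update z N w '' (T : Set ℕ) = z '' (T : Set ℕ) := fun T hT =>
    Set.image_congr fun i hi => hup i (by simpa using hT hi)
  constructor
  · intro i hi
    by_cases h1 : i < N
    · rw [hup i h1]; exact h.mem i h1
    · obtain rfl : i = N := by omega
      simpa using hwZ
  · rw [Finset.range_add_one, Finset.coe_insert, linearIndepOn_insert (by simp)]
    constructor
    · exact (linearIndepOn_congr fun i hi => hup i (by simpa using hi)).mpr h.indep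
    · rw [himg _ subset_rfl, Function.update_self]; exact hwA
  · intro T hT hTc y hy hyT
    by_cases hNT : N ∈ T
    · set T' := T.erase N with hT'
      have hT'N : T' ⊆ Finset.range N := by
        intro i hi
        have h1 := Finset.mem_erase.mp hi
        have h2 := Finset.mem_range.mp (hT h1.2)
        exact Finset.mem_range.mpr (by omega)
      have hT'm : T' ∈ (Finset.range N).powersetCard t := by
        rw [Finset.mem_powersetCard]
        exact ⟨hT'N, by rw [hT', Finset.card_erase_of_mem hNT, hTc]; rfl⟩
      have h1 : Function.update z N w '' (T : Set ℕ) = insert w (z '' (T' : Set ℕ)) := by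
        rw [← Finset.insert_erase hNT, Finset.coe_insert, Set.image_insert_eq, himg _ hT'N,
          Function.update_self]
      rw [h1, Submodule.mem_span_insert] at hyT
      obtain ⟨a, v, hv, e⟩ := hyT
      by_cases ha : a = 0
      · rw [ha, zero_smul, zero_add] at e
        exact hTd' T' hT'm y hy (e ▸ hv)
      · refine absurd ?_ (hw (Sum.inr T') (Finset.inr_mem_disjSum.mpr hT'm))
        refine ⟨-(a⁻¹ • v), Submodule.neg_mem _ (Submodule.smul_mem _ _ hv), a⁻¹ • y,
          hY.smul_mem _ hy _, ?_⟩
        rw [e, smul_add, smul_smul, inv_mul_cancel₀ ha, one_smul]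
        abel
    · have hTN : T ⊆ Finset.range N := by
        intro i hi
        have h2 := Finset.mem_range.mp (hT hi)
        have h3 : i ≠ N := fun h => hNT (h ▸ hi)
        exact Finset.mem_range.mpr (by omega)
      rw [himg T hTN] at hyT
      exact h.disj T hTN hTc y hy hyT

theorem GenPos.exists_extend_le [IsAlgClosed k] {Y Z : Set (ι → k)} (hY : IsProjVariety k ι Y)
    (hYn : Nondeg k ι Y) (hZ : (vanIdeal k ι Z).IsPrime) (hZn : Nondeg k ι Z) {t M : ℕ}
    {z : ℕ → ι → k} (h : GenPos Y Z (t + 1) M z) (ht : t < M) {N : ℕ} (hMN : M ≤ N)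
    (hN : N ≤ Fintype.card ι) : ∃ z', (∀ i < M, z' i = z i) ∧ GenPos Y Z (t + 1) N z' := by
  induction N, hMN using Nat.le_induction with
  | base => exact ⟨z, fun _ _ => rfl, h⟩
  | succ N hMN ih =>
    obtain ⟨z', hz', h'⟩ := ih (by omega)
    obtain ⟨w, -, hw⟩ := h'.exists_extend hY hYn hZ hZn (by omega) (by omega) ∅ (by simp)
    refine ⟨_, fun i hi => ?_, hw⟩
    rw [Function.update_of_ne (by omega), hz' i hi]

theorem GenPos.exists_relation {Y Z : Set (ι → k)} {t N : ℕ} {z : ℕ → ι → k}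
    (h : GenPos Y Z t N z) (hP : ∀ Q z, Q.card = t + 1 → ¬ FreeFrom Y Z Q z) {Q : Finset ℕ}
    (hQN : Q ⊆ Finset.range N) (hQ : Q.card = t + 1) :
    ∃ a : ℕ → k, (∀ i ∈ Q, a i ≠ 0) ∧ ∑ i ∈ Q, a i • z i ∈ Y := by
  have h1 : ∃ y ∈ Y, y ∈ Submodule.span k (z '' (Q : Set ℕ)) ∧ y ≠ 0 := by
    by_contra! h1
    exact hP Q z hQ ⟨fun i hi => h.mem i (by simpa using hQN hi),
      h.indep.mono (by exact_mod_cast hQN), h1⟩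
  obtain ⟨y, hy, hyQ, hy0⟩ := h1
  obtain ⟨a, rfl⟩ := (Submodule.mem_span_image_finset_iff_exists_fun' k).mp hyQ
  refine ⟨a, fun i hi hai => hy0 ?_, hy⟩
  refine h.disj (Q.erase i) ((Finset.erase_subset _ _).trans hQN)
    (by rw [Finset.card_erase_of_mem hi, hQ]; rfl) _ hy ?_
  rw [← Finset.add_sum_erase _ _ hi, hai, zero_smul, zero_add]
  exact Submodule.sum_mem _ fun j hj => Submodule.smul_mem _ _ (Submodule.subset_span ⟨j, hj, rfl⟩)

end Position

section Polar

variable {k : Type} [Field k] {ι : Type} [Fintype ι] [DecidableEq ι]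

/-- The Hessian at the origin, as a bilinear form depending linearly on the polynomial.
On quadratic forms it is the polar form. -/
def polarForm : MvPolynomial ι k →ₗ[k] LinearMap.BilinForm k (ι → k) :=
  Matrix.toBilin'.toLinearMap ∘ₗ LinearMap.pi fun i => LinearMap.pi fun j =>
    (aeval (0 : ι → k)).toLinearMap ∘ₗ (pderiv i).toLinearMap ∘ₗ (pderiv j).toLinearMap

theorem polarForm_apply (q : MvPolynomial ι k) (u v : ι → k) :
    polarForm q u v = ∑ i, ∑ j, u i * eval 0 (pderiv i (pderiv j q)) * v j := by
  change Matrix.toBilin' _ u v = _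
  rw [Matrix.toBilin'_apply]
  rfl

theorem polarForm_comm (q : MvPolynomial ι k) (u v : ι → k) :
    polarForm q u v = polarForm q v u := by
  rw [polarForm_apply, polarForm_apply, Finset.sum_comm]
  refine Finset.sum_congr rfl fun i _ => Finset.sum_congr rfl fun j _ => ?_
  have h : pderiv j (pderiv i q) = pderiv i (pderiv j q) := by
    have h1 : ⁅(pderiv j : Derivation k (MvPolynomial ι k) (MvPolynomial ι k)),
        (pderiv i : Derivation k (MvPolynomial ι k) (MvPolynomial ι k))⁆ = 0 := by
      refine MvPolynomial.derivation_ext fun l => ?_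
      rw [Derivation.commutator_apply, pderiv_X, pderiv_X]
      simp only [Pi.single_apply]
      split_ifs <;> simp
    have h2 := congrArg (fun D => D q) h1
    rw [Derivation.commutator_apply] at h2
    exact sub_eq_zero.mp h2
  rw [h]
  ring

theorem polarForm_self {q : MvPolynomial ι k} (hq : q ∈ homogeneousSubmodule ι k 2)
    (v : ι → k) : polarForm q v v = 2 * eval v q := by
  have hq : q.IsHomogeneous 2 := hq
  have h0 : ∀ f : MvPolynomial ι k, f.IsHomogeneous 0 → eval v f = eval 0 f := by
    intro f hf
    have h := eval_smul_of_isHomogeneous hf 0 v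
    rwa [zero_smul, pow_zero, one_mul, eq_comm] at h
  have h1 := congrArg (eval v) hq.sum_X_mul_pderiv
  rw [polarForm_apply, Finset.sum_comm]
  simp only [map_sum, map_mul, eval_X, nsmul_eq_mul, Nat.cast_ofNat, map_ofNat] at h1
  rw [← h1]
  refine Finset.sum_congr rfl fun j _ => ?_
  have hj : (pderiv j q).IsHomogeneous 1 := hq.pderiv
  have h2 := congrArg (eval v) hj.sum_X_mul_pderiv
  simp only [map_sum, map_mul, eval_X, one_nsmul] at h2
  rw [← h2, Finset.mul_sum]
  refine Finset.sum_congr rfl fun i _ => ?_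
  rw [h0 _ hj.pderiv]
  ring

theorem eq_zero_of_polarForm_eq_zero [CharZero k] {q : MvPolynomial ι k}
    (hq : q ∈ homogeneousSubmodule ι k 2) (h : ∀ v, polarForm q v v = 0) : q = 0 := by
  refine MvPolynomial.funext fun v => ?_
  have := h v
  rw [polarForm_self hq] at this
  simpa using this

/-- A quadric through a nondegenerate variety does not contain a hyperplane. -/
theorem eq_zero_of_polarForm_eq_zero_on_hyperplane [CharZero k] {Y : Set (ι → k)}
    (hY : (vanIdeal k ι Y).IsPrime) (hnd : Nondeg k ι Y) {q : MvPolynomial ι k}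
    (hq : q ∈ quadrics k ι Y) {W : Submodule k (ι → k)}
    (hW : Fintype.card ι ≤ Module.finrank k W + 1)
    (h : ∀ u ∈ W, ∀ v ∈ W, polarForm q u v = 0) : q = 0 := by
  have hq2 : q ∈ homogeneousSubmodule ι k 2 := hq.2
  by_cases hWt : ∀ e, e ∈ W
  · exact eq_zero_of_polarForm_eq_zero hq2 fun v => h v (hWt v) v (hWt v)
  push Not at hWt
  obtain ⟨e, he⟩ := hWt
  obtain ⟨φ, hφ, hφW⟩ := exists_dual_ne_zero_of_notMem he
  have hker : W = LinearMap.ker φ := by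
    apply Submodule.eq_of_le_of_finrank_le (fun w hw => hφW w hw)
    have h1 := LinearMap.finrank_range_add_finrank_ker φ
    have h2 : LinearMap.range φ ≠ ⊥ := by
      rw [Ne, LinearMap.range_eq_bot]
      rintro rfl
      exact hφ rfl
    have h3 := Submodule.one_le_finrank_iff.mpr h2
    rw [Module.finrank_fintype_fun_eq_card] at h1
    omega
  obtain ⟨ψ, hψ⟩ : ∃ ψ : Module.Dual k (ι → k), ∀ v, 2 * eval v q = φ v * ψ v := by
    refine ⟨(2 * (φ e)⁻¹) • polarForm q e - ((φ e)⁻¹ ^ 2 * polarForm q e e) • φ, fun v => ?_⟩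
    have hv : v - ((φ e)⁻¹ * φ v) • e ∈ W := by
      rw [hker, LinearMap.mem_ker, map_sub, map_smul, smul_eq_mul]
      field_simp
      ring
    have h1 := h _ hv _ hv
    simp only [map_sub, map_smul, LinearMap.sub_apply, LinearMap.smul_apply, smul_eq_mul] at h1 ⊢
    rw [polarForm_self hq2, polarForm_comm q v e] at h1
    linear_combination h1
  have hmem : linForm φ * linForm ψ ∈ vanIdeal k ι Y := by
    rw [mem_vanIdeal]
    intro x hx
    rw [map_mul, eval_linForm, eval_linForm, ← hψ, mem_vanIdeal.mp hq.1 x hx, mul_zero]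
  rcases hY.mem_or_mem hmem with h1 | h1
  · refine absurd ?_ hφ
    have h2 : φ = 0 := linForm_eq_zero_of_nondeg hnd fun y hy => by
      rw [← eval_linForm]; exact mem_vanIdeal.mp h1 y hy
    rw [h2]
    rfl
  · have h2 : ψ = 0 := linForm_eq_zero_of_nondeg hnd fun y hy => by
      rw [← eval_linForm]; exact mem_vanIdeal.mp h1 y hy
    refine MvPolynomial.funext fun v => ?_
    have := hψ v
    rw [h2] at this
    simpa using this

theorem polarForm_self_eq_zero {Y : Set (ι → k)} {q : MvPolynomial ι k}
    (hq : q ∈ quadrics k ι Y) {v : ι → k} (hv : v ∈ quadZero k ι Y) : polarForm q v v = 0 := by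
  rw [polarForm_self hq.2, hv q hq, mul_zero]

theorem subset_quadZero (Y : Set (ι → k)) : Y ⊆ quadZero k ι Y :=
  fun y hy _ hq => mem_vanIdeal.mp hq.1 y hy

/-- A quadric whose polar form vanishes at pairs of enough independent zeros is zero. -/
theorem eq_zero_of_polarForm_eq_zero_on_pairs [CharZero k] {Y : Set (ι → k)}
    (hY : (vanIdeal k ι Y).IsPrime) (hnd : Nondeg k ι Y) {q : MvPolynomial ι k}
    (hq : q ∈ quadrics k ι Y) {N : ℕ} (hN : Fintype.card ι ≤ N + 1) {z : ℕ → ι → k}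
    (hz : ∀ i < N, z i ∈ quadZero k ι Y) (hind : LinearIndepOn k z (Finset.range N))
    (h : ∀ i j, i < j → j < N → polarForm q (z i) (z j) = 0) : q = 0 := by
  refine eq_zero_of_polarForm_eq_zero_on_hyperplane hY hnd hq
    (W := Submodule.span k (z '' (Finset.range N : Set ℕ))) ?_ ?_
  · have h1 := finrank_span_eq_card hind.linearIndependent
    rw [← Set.image_eq_range] at h1
    simp only [Finset.coe_sort_coe, Fintype.card_coe, Finset.card_range] at h1
    omega
  · intro u hu v hv
    rw [Submodule.mem_span_image_finset_iff_exists_fun'] at hu hv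
    obtain ⟨a, rfl⟩ := hu
    obtain ⟨b, rfl⟩ := hv
    simp only [map_sum, LinearMap.sum_apply, map_smul, LinearMap.smul_apply, smul_eq_mul, Finset.mul_sum]
    refine Finset.sum_eq_zero fun i hi => Finset.sum_eq_zero fun j hj => ?_
    rw [Finset.mem_range] at hi hj
    rcases lt_trichotomy j i with hij | rfl | hij
    · rw [h _ _ hij hi]; ring
    · rw [polarForm_self_eq_zero hq (hz _ hi)]; ring
    · rw [polarForm_comm, h _ _ hij hj]; ring

end Polar

section Uniqueness

variable {k : Type} [Field k] {ι : Type} [Fintype ι] [DecidableEq ι]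

theorem finrank_quadrics_le_of_injective {Y : Set (ι → k)} {α : Type} [Fintype α]
    (Φ : quadrics k ι Y →ₗ[k] (α → k)) (h : ∀ q, Φ q = 0 → q = 0) :
    Module.finrank k (quadrics k ι Y) ≤ Fintype.card α := by
  rw [← Module.finrank_fintype_fun_eq_card k]
  exact LinearMap.finrank_le_finrank_of_injective
    (LinearMap.ker_eq_bot.mp (LinearMap.ker_eq_bot'.mpr h))

/-- The map recording the values of the polar forms at prescribed pairs of vectors. -/
def polarAt (Y : Set (ι → k)) {α : Type} (u v : α → ι → k) : quadrics k ι Y →ₗ[k] (α → k) :=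
  LinearMap.pi fun a => (LinearMap.applyₗ (v a)) ∘ₗ (LinearMap.applyₗ (u a)) ∘ₗ polarForm ∘ₗ
    (quadrics k ι Y).subtype

theorem polarAt_apply (Y : Set (ι → k)) {α : Type} (u v : α → ι → k) (q : quadrics k ι Y) (a : α) :
    polarAt Y u v q a = polarForm (q : MvPolynomial ι k) (u a) (v a) := rfl

/-- Normalization of a relation. -/
theorem GenPos.exists_relation_eq_one {Y Z : Set (ι → k)} (hY : ∀ x ∈ Y, ∀ t : k, t • x ∈ Y)
    {t N : ℕ} {z : ℕ → ι → k}
    (h : GenPos Y Z t N z) (hP : ∀ Q z, Q.card = t + 1 → ¬ FreeFrom Y Z Q z) {Q : Finset ℕ}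
    (hQN : Q ⊆ Finset.range N) (hQ : Q.card = t + 1) {i : ℕ} (hi : i ∈ Q) :
    ∃ a : ℕ → k, (∀ j ∈ Q, a j ≠ 0) ∧ a i = 1 ∧ ∑ j ∈ Q, a j • z j ∈ Y := by
  obtain ⟨a, ha, hay⟩ := h.exists_relation hP hQN hQ
  refine ⟨fun j => (a i)⁻¹ * a j, fun j hj => mul_ne_zero (inv_ne_zero (ha i hi)) (ha j hj),
    inv_mul_cancel₀ (ha i hi), ?_⟩
  have := hY _ hay (a i)⁻¹
  simpa only [Finset.smul_sum, smul_smul] using this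

section Relations

variable [CharZero k] {Y Z : Set (ι → k)} {q : MvPolynomial ι k} {z : ℕ → ι → k} {a : ℕ → k}

theorem polarForm_relation_two (hq : q ∈ quadrics k ι Y) {i j : ℕ}
    (hi : z i ∈ quadZero k ι Y) (hj : z j ∈ quadZero k ι Y) (hij : i ≠ j)
    (h : ∑ l ∈ {i, j}, a l • z l ∈ Y) : a i * a j * polarForm q (z i) (z j) = 0 := by
  have h1 := polarForm_self_eq_zero hq (subset_quadZero Y h)
  rw [Finset.sum_pair hij] at h1
  simp only [map_add, map_smul, LinearMap.add_apply, LinearMap.smul_apply, smul_eq_mul,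
    polarForm_self_eq_zero hq hi, polarForm_self_eq_zero hq hj, polarForm_comm q (z j) (z i)] at h1
  have h2 : (2 : k) ≠ 0 := two_ne_zero
  exact mul_left_cancel₀ h2 (by linear_combination h1)

theorem polarForm_relation_three (hq : q ∈ quadrics k ι Y) {i j l : ℕ}
    (hi : z i ∈ quadZero k ι Y) (hj : z j ∈ quadZero k ι Y) (hl : z l ∈ quadZero k ι Y)
    (hij : i ≠ j) (hil : i ≠ l) (hjl : j ≠ l) (h : ∑ m ∈ {i, j, l}, a m • z m ∈ Y) :
    a i * a j * polarForm q (z i) (z j) + a i * a l * polarForm q (z i) (z l) +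
      a j * a l * polarForm q (z j) (z l) = 0 := by
  have h1 := polarForm_self_eq_zero hq (subset_quadZero Y h)
  rw [Finset.sum_insert (by simp [hij, hil]), Finset.sum_pair hjl] at h1
  simp only [map_add, map_smul, LinearMap.add_apply, LinearMap.smul_apply, smul_eq_mul,
    polarForm_self_eq_zero hq hi, polarForm_self_eq_zero hq hj, polarForm_self_eq_zero hq hl,
    polarForm_comm q (z j) (z i), polarForm_comm q (z l) (z i), polarForm_comm q (z l) (z j)] at h1
  have h2 : (2 : k) ≠ 0 := two_ne_zero
  exact mul_left_cancel₀ h2 (by linear_combination h1)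

theorem polarForm_relation_four (hq : q ∈ quadrics k ι Y) {i j l m : ℕ}
    (hi : z i ∈ quadZero k ι Y) (hj : z j ∈ quadZero k ι Y) (hl : z l ∈ quadZero k ι Y)
    (hm : z m ∈ quadZero k ι Y) (hij : i ≠ j) (hil : i ≠ l) (him : i ≠ m) (hjl : j ≠ l)
    (hjm : j ≠ m) (hlm : l ≠ m) (h : ∑ n ∈ {i, j, l, m}, a n • z n ∈ Y) :
    a i * a j * polarForm q (z i) (z j) + a i * a l * polarForm q (z i) (z l) +
      a i * a m * polarForm q (z i) (z m) + a j * a l * polarForm q (z j) (z l) +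
      a j * a m * polarForm q (z j) (z m) + a l * a m * polarForm q (z l) (z m) = 0 := by
  have h1 := polarForm_self_eq_zero hq (subset_quadZero Y h)
  rw [Finset.sum_insert (by simp [hij, hil, him]), Finset.sum_insert (by simp [hjl, hjm]),
    Finset.sum_pair hlm] at h1
  simp only [map_add, map_smul, LinearMap.add_apply, LinearMap.smul_apply, smul_eq_mul,
    polarForm_self_eq_zero hq hi, polarForm_self_eq_zero hq hj, polarForm_self_eq_zero hq hl,
    polarForm_self_eq_zero hq hm,
    polarForm_comm q (z j) (z i), polarForm_comm q (z l) (z i), polarForm_comm q (z m) (z i),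
    polarForm_comm q (z l) (z j), polarForm_comm q (z m) (z j), polarForm_comm q (z m) (z l)] at h1
  have h2 : (2 : k) ≠ 0 := two_ne_zero
  exact mul_left_cancel₀ h2 (by linear_combination h1)

end Relations

theorem exists_freeFrom_two [CharZero k] {Y Z : Set (ι → k)} (hY : IsProjVariety k ι Y)
    (hnd : Nondeg k ι Y) (hZ : Z ⊆ quadZero k ι Y)
    (hd : 0 < Module.finrank k (quadrics k ι Y)) {z : ℕ → ι → k}
    (h : GenPos Y Z 1 (Fintype.card ι) z) : ∃ Q z, Q.card = 2 ∧ FreeFrom Y Z Q z := by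
  by_contra! hP
  have h0 : quadrics k ι Y = ⊥ := by
    rw [eq_bot_iff]
    intro q hq
    refine eq_zero_of_polarForm_eq_zero_on_pairs hY.prime hnd hq (Nat.le_succ _)
      (fun i hi => hZ (h.mem i hi)) h.indep fun i j hij hj => ?_
    obtain ⟨a, ha, hay⟩ := h.exists_relation hP (Q := {i, j})
      (by intro m; simp only [Finset.mem_insert, Finset.mem_singleton, Finset.mem_range]; omega)
      (Finset.card_pair hij.ne)
    have h1 := polarForm_relation_two hq (hZ (h.mem i (by omega))) (hZ (h.mem j hj)) hij.ne hay
    have hi0 := ha i (by simp)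
    have hj0 := ha j (by simp)
    simpa [hi0, hj0] using h1
  rw [h0, finrank_bot] at hd
  exact hd.false

theorem exists_freeFrom_three [CharZero k] {Y Z : Set (ι → k)} (hY : IsProjVariety k ι Y)
    (hnd : Nondeg k ι Y) (hZ : Z ⊆ quadZero k ι Y)
    (hd : Fintype.card ι < Module.finrank k (quadrics k ι Y)) {z : ℕ → ι → k}
    (h : GenPos Y Z 2 (Fintype.card ι) z) : ∃ Q z, Q.card = 3 ∧ FreeFrom Y Z Q z := by
  by_contra! hP
  refine hd.not_ge ((finrank_quadrics_le_of_injective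
    (polarAt Y (fun _ : Fin (Fintype.card ι) => z 0) (fun j => z j)) ?_).trans
    (Fintype.card_fin _).le)
  rintro ⟨q, hq⟩ h0
  have h0 : ∀ j < Fintype.card ι, polarForm q (z 0) (z j) = 0 := fun j hj =>
    congrFun h0 ⟨j, hj⟩
  rw [Submodule.mk_eq_zero]
  refine eq_zero_of_polarForm_eq_zero_on_pairs hY.prime hnd hq (Nat.le_succ _)
    (fun i hi => hZ (h.mem i hi)) h.indep fun i j hij hj => ?_
  rcases Nat.eq_zero_or_pos i with rfl | hi
  · exact h0 j hj
  obtain ⟨a, ha, hay⟩ := h.exists_relation hP (Q := {0, i, j})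
    (by intro m; simp only [Finset.mem_insert, Finset.mem_singleton, Finset.mem_range]; omega)
    (Finset.card_eq_three.mpr ⟨0, i, j, by omega, by omega, by omega, rfl⟩)
  have h1 := polarForm_relation_three hq (hZ (h.mem 0 (by omega))) (hZ (h.mem i (by omega)))
    (hZ (h.mem j hj)) (by omega) (by omega) (by omega) hay
  have hi0 := ha i (by simp)
  have hj0 := ha j (by simp)
  simpa [hi0, hj0, h0 j hj, h0 i (by omega)] using h1

/-- If there is no free quadruple, the polar products with the first two points can be
prescribed arbitrarily. -/
theorem exists_quadric_polarForm_eq [CharZero k] {Y Z : Set (ι → k)} (hY : IsProjVariety k ι Y)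
    (hnd : Nondeg k ι Y) (hZ : Z ⊆ quadZero k ι Y) (hι : 4 ≤ Fintype.card ι)
    (hd : 2 * Fintype.card ι ≤ Module.finrank k (quadrics k ι Y) + 5) {z : ℕ → ι → k}
    (h : GenPos Y Z 3 (Fintype.card ι) z) (hP : ∀ Q z, Q.card = 4 → ¬ FreeFrom Y Z Q z)
    (s : k) (f g : ℕ → k) : ∃ q ∈ quadrics k ι Y, polarForm q (z 0) (z 1) = s ∧
      ∀ j, 2 ≤ j → j + 1 < Fintype.card ι →
        polarForm q (z 0) (z j) = f j ∧ polarForm q (z 1) (z j) = g j := by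
  let u : Option (Fin (Fintype.card ι - 3) ⊕ Fin (Fintype.card ι - 3)) → ι → k := fun o =>
    o.elim (z 0) (Sum.elim (fun _ => z 0) (fun _ => z 1))
  let v : Option (Fin (Fintype.card ι - 3) ⊕ Fin (Fintype.card ι - 3)) → ι → k := fun o =>
    o.elim (z 1) (Sum.elim (fun j => z (j + 2)) (fun j => z (j + 2)))
  have hinj : ∀ q, polarAt Y u v q = 0 → q = 0 := by
    rintro ⟨q, hq⟩ h0
    have h01 : polarForm q (z 0) (z 1) = 0 := congrFun h0 none
    have h0j : ∀ j, 2 ≤ j → j + 1 < Fintype.card ι → polarForm q (z 0) (z j) = 0 := by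
      intro j h1 h2
      have := congrFun h0 (some (Sum.inl ⟨j - 2, by omega⟩))
      rw [polarAt_apply] at this
      simpa [u, v, Nat.sub_add_cancel h1] using this
    have h1j : ∀ j, 2 ≤ j → j + 1 < Fintype.card ι → polarForm q (z 1) (z j) = 0 := by
      intro j h1 h2
      have := congrFun h0 (some (Sum.inr ⟨j - 2, by omega⟩))
      rw [polarAt_apply] at this
      simpa [u, v, Nat.sub_add_cancel h1] using this
    rw [Submodule.mk_eq_zero]
    refine eq_zero_of_polarForm_eq_zero_on_pairs hY.prime hnd hq (N := Fintype.card ι - 1)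
      (by omega) (fun i hi => hZ (h.mem i (by omega)))
      (h.indep.mono (by
        intro m; simp only [Finset.coe_range, Set.mem_Iio]; omega)) fun i j hij hj => ?_
    rcases (by omega : i = 0 ∧ j = 1 ∨ i = 0 ∧ 2 ≤ j ∨ i = 1 ∧ 2 ≤ j ∨ 2 ≤ i) with
      ⟨rfl, rfl⟩ | ⟨rfl, hj2⟩ | ⟨rfl, hj2⟩ | hi
    · exact h01
    · exact h0j j hj2 (by omega)
    · exact h1j j hj2 (by omega)
    obtain ⟨a, ha, hay⟩ := h.exists_relation hP (Q := {0, 1, i, j})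
      (by intro m; simp only [Finset.mem_insert, Finset.mem_singleton, Finset.mem_range]; omega)
      (by rw [Finset.card_insert_of_notMem (by simp; omega),
        Finset.card_insert_of_notMem (by simp; omega), Finset.card_pair hij.ne])
    have h1 := polarForm_relation_four hq (hZ (h.mem 0 (by omega))) (hZ (h.mem 1 (by omega)))
      (hZ (h.mem i (by omega))) (hZ (h.mem j (by omega))) (by omega) (by omega) (by omega)
      (by omega) (by omega) (by omega) hay
    have hi0 := ha i (by simp)
    have hj0 := ha j (by simp)
    simpa [hi0, hj0, h01, h0j j (by omega) (by omega), h0j i (by omega) (by omega),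
      h1j j (by omega) (by omega), h1j i (by omega) (by omega)] using h1
  have hcard : Fintype.card (Option (Fin (Fintype.card ι - 3) ⊕ Fin (Fintype.card ι - 3))) =
      2 * (Fintype.card ι - 3) + 1 := by
    rw [Fintype.card_option, Fintype.card_sum, Fintype.card_fin]; ring
  have hle := finrank_quadrics_le_of_injective _ hinj
  have hker := LinearMap.ker_eq_bot.mp (LinearMap.ker_eq_bot'.mpr hinj)
  have : FiniteDimensional k (quadrics k ι Y) := FiniteDimensional.of_injective _ hker
  have hsurj : Function.Surjective (polarAt Y u v) := by
    rw [← LinearMap.injective_iff_surjective_of_finrank_eq_finrank]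
    · exact hker
    · rw [Module.finrank_fintype_fun_eq_card]
      omega
  obtain ⟨q, hq⟩ := hsurj fun o => o.elim s (Sum.elim (fun j => f (j + 2)) (fun j => g (j + 2)))
  refine ⟨q, q.2, congrFun hq none, fun j h1 h2 => ⟨?_, ?_⟩⟩
  · have := congrFun hq (some (Sum.inl ⟨j - 2, by omega⟩))
    rw [polarAt_apply] at this
    simpa [u, v, Nat.sub_add_cancel h1] using this
  · have := congrFun hq (some (Sum.inr ⟨j - 2, by omega⟩))
    rw [polarAt_apply] at this
    simpa [u, v, Nat.sub_add_cancel h1] using this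

/-- If there is no free quadruple, then the points of the curve on two adjacent spans of four
points in general position are conjugate with respect to all quadrics through the curve. -/
theorem polarForm_eq_zero_of_genPos [CharZero k] {Y Z : Set (ι → k)} (hY : IsProjVariety k ι Y)
    (hnd : Nondeg k ι Y) (hZ : Z ⊆ quadZero k ι Y) (hι : 6 ≤ Fintype.card ι)
    (hd : 2 * Fintype.card ι ≤ Module.finrank k (quadrics k ι Y) + 5) {z : ℕ → ι → k}
    (h : GenPos Y Z 3 (Fintype.card ι) z) (hP : ∀ Q z, Q.card = 4 → ¬ FreeFrom Y Z Q z)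
    {a c : ℕ → k} (ha : ∀ i ∈ ({0, 1, 2, 3} : Finset ℕ), a i ≠ 0)
    (hc : ∀ i ∈ ({0, 1, 2, 4} : Finset ℕ), c i ≠ 0) (ha1 : a 1 = 1) (hc1 : c 1 = 1)
    (hay : ∑ i ∈ {0, 1, 2, 3}, a i • z i ∈ Y) (hcy : ∑ i ∈ {0, 1, 2, 4}, c i • z i ∈ Y)
    {q : MvPolynomial ι k} (hq : q ∈ quadrics k ι Y) :
    polarForm q (∑ i ∈ {0, 1, 2, 3}, a i • z i) (∑ i ∈ {0, 1, 2, 4}, c i • z i) = 0 := by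
  have hsub : ∀ Q : Finset ℕ, (∀ i ∈ Q, i < 5) → Q ⊆ Finset.range (Fintype.card ι) :=
    fun Q hQ i hi => Finset.mem_range.mpr ((hQ i hi).trans (by omega))
  obtain ⟨e, he, he1, hey⟩ := h.exists_relation_eq_one hY.smul_mem hP (Q := {0, 1, 3, 4})
    (hsub _ (by decide)) rfl (i := 1) (by decide)
  obtain ⟨f, hf, hfy⟩ := h.exists_relation hP (Q := {0, 2, 3, 4}) (hsub _ (by decide)) rfl
  have hz : ∀ i < 5, z i ∈ quadZero k ι Y := fun i hi => hZ (h.mem i (by omega))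
  simp only [Finset.mem_insert, Finset.mem_singleton, forall_eq_or_imp, forall_eq] at ha hc he hf
  obtain ⟨ha0, -, ha2, ha3⟩ := ha
  obtain ⟨hc0, -, hc2, hc4⟩ := hc
  obtain ⟨he0, -, he3, he4⟩ := he
  obtain ⟨hf0, hf2, hf3, hf4⟩ := hf
  obtain ⟨P, hPe⟩ : ∃ P, P * (a 2 * a 3) = f 2 * f 3 := ⟨f 2 * f 3 / (a 2 * a 3), by field_simp⟩
  obtain ⟨R, hRe⟩ : ∃ R, R * (c 2 * c 4) = f 2 * f 4 := ⟨f 2 * f 4 / (c 2 * c 4), by field_simp⟩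
  obtain ⟨S, hSe⟩ : ∃ S, S * (e 3 * e 4) = f 3 * f 4 := ⟨f 3 * f 4 / (e 3 * e 4), by field_simp⟩
  have hP0 : P ≠ 0 := by rintro rfl; simp [hf2, hf3] at hPe
  have hR0 : R ≠ 0 := by rintro rfl; simp [hf2, hf4] at hRe
  have hS0 : S ≠ 0 := by rintro rfl; simp [hf3, hf4] at hSe
  have key : ∀ s x₂ x₃ x₄ y₂ y₃ y₄ : k,
      (P * a 0 + R * c 0 + S * e 0) * s + (P * a 0 * a 2 + R * c 0 * c 2 - f 0 * f 2) * x₂ +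
        (P * a 0 * a 3 + S * e 0 * e 3 - f 0 * f 3) * x₃ +
        (R * c 0 * c 4 + S * e 0 * e 4 - f 0 * f 4) * x₄ + (P * a 2 + R * c 2) * y₂ +
        (P * a 3 + S * e 3) * y₃ + (R * c 4 + S * e 4) * y₄ = 0 := by
    intro s x₂ x₃ x₄ y₂ y₃ y₄
    obtain ⟨q, hq, h01, hj⟩ := exists_quadric_polarForm_eq hY hnd hZ (by omega) hd h hP s
      (fun j => if j = 2 then x₂ else if j = 3 then x₃ else x₄)
      (fun j => if j = 2 then y₂ else if j = 3 then y₃ else y₄)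
    obtain ⟨h02, h12⟩ := hj 2 le_rfl (by omega)
    obtain ⟨h03, h13⟩ := hj 3 (by omega) (by omega)
    obtain ⟨h04, h14⟩ := hj 4 (by omega) (by omega)
    norm_num at h02 h12 h03 h13 h04 h14
    have e1 := polarForm_relation_four hq (hz 0 (by omega)) (hz 1 (by omega)) (hz 2 (by omega))
      (hz 3 (by omega)) (by omega) (by omega) (by omega) (by omega) (by omega) (by omega) hay
    have e2 := polarForm_relation_four hq (hz 0 (by omega)) (hz 1 (by omega)) (hz 2 (by omega))
      (hz 4 (by omega)) (by omega) (by omega) (by omega) (by omega) (by omega) (by omega) hcy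
    have e3 := polarForm_relation_four hq (hz 0 (by omega)) (hz 1 (by omega)) (hz 3 (by omega))
      (hz 4 (by omega)) (by omega) (by omega) (by omega) (by omega) (by omega) (by omega) hey
    have e4 := polarForm_relation_four hq (hz 0 (by omega)) (hz 2 (by omega)) (hz 3 (by omega))
      (hz 4 (by omega)) (by omega) (by omega) (by omega) (by omega) (by omega) (by omega) hfy
    rw [h01, h02, h03, h12, h13, ha1] at e1
    rw [h01, h02, h04, h12, h14, hc1] at e2
    rw [h01, h03, h04, h13, h14, he1] at e3
    rw [h02, h03, h04] at e4
    linear_combination P * e1 + R * e2 + S * e3 - e4 - polarForm q (z 2) (z 3) * hPe -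
      polarForm q (z 2) (z 4) * hRe - polarForm q (z 3) (z 4) * hSe
  have k0 := key 1 0 0 0 0 0 0
  have k2 := key 0 1 0 0 0 0 0
  have k3 := key 0 0 1 0 0 0 0
  have k4 := key 0 0 0 1 0 0 0
  have w2 := key 0 0 0 0 1 0 0
  have w3 := key 0 0 0 0 0 1 0
  have w4 := key 0 0 0 0 0 0 1
  simp only [mul_one, mul_zero, add_zero, zero_add] at k0 k2 k3 k4 w2 w3 w4
  have E1 : f 0 * a 2 = (a 0 - e 0) * f 2 := by
    refine mul_left_cancel₀ (mul_ne_zero hP0 ha3) ?_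
    linear_combination f 0 * hPe - f 2 * k3 + f 2 * e 0 * w3
  have E2 : f 0 * c 2 = (c 0 - e 0) * f 2 := by
    refine mul_left_cancel₀ (mul_ne_zero hR0 hc4) ?_
    linear_combination f 0 * hRe - f 2 * k4 + f 2 * e 0 * w4
  have hsum : P + R + S = 0 := by
    refine (mul_eq_zero.mp (?_ : (e 0 * f 2) * (P + R + S) = 0)).resolve_left (mul_ne_zero he0 hf2)
    linear_combination f 2 * k0 + P * E1 + R * E2 - f 0 * w2
  have hvec : S • ∑ i ∈ {0, 1, 3, 4}, e i • z i =
      -(P • ∑ i ∈ {0, 1, 2, 3}, a i • z i + R • ∑ i ∈ {0, 1, 2, 4}, c i • z i) := by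
    ext m
    simp only [Pi.smul_apply, Pi.neg_apply, Pi.add_apply, smul_eq_mul, Finset.sum_apply]
    rw [Finset.sum_insert (by decide), Finset.sum_insert (by decide), Finset.sum_pair (by decide),
      Finset.sum_insert (by decide), Finset.sum_insert (by decide), Finset.sum_pair (by decide),
      Finset.sum_insert (by decide), Finset.sum_insert (by decide), Finset.sum_pair (by decide),
      ha1, hc1, he1]
    linear_combination z 0 m * k0 + z 1 m * hsum + z 2 m * w2 + z 3 m * w3 + z 4 m * w4
  have hB := polarForm_self_eq_zero hq (subset_quadZero Y (hY.smul_mem _ hey S))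
  have hA := polarForm_self_eq_zero hq (subset_quadZero Y hay)
  have hC := polarForm_self_eq_zero hq (subset_quadZero Y hcy)
  rw [hvec] at hB
  simp only [map_neg, map_add, map_smul, LinearMap.neg_apply, LinearMap.add_apply,
    LinearMap.smul_apply, smul_eq_mul, hA, hC, polarForm_comm q (∑ i ∈ {0, 1, 2, 4}, c i • z i)] at hB
  have h2 : (2 * P * R : k) ≠ 0 := mul_ne_zero (mul_ne_zero two_ne_zero hP0) hR0
  refine (mul_eq_zero.mp (?_ : (2 * P * R) * _ = 0)).resolve_left h2
  linear_combination hB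

theorem span_image_range_sup_ne_top {z : ℕ → ι → k} {N : ℕ} (hN : N + 1 < Fintype.card ι)
    (f : ι → k) : Submodule.span k (z '' (Finset.range N : Set ℕ)) ⊔ Submodule.span k {f} ≠ ⊤ := by
  classical
  intro h
  have h1 : Module.finrank k (Submodule.span k (z '' (Finset.range N : Set ℕ))) ≤ N := by
    have := finrank_span_finset_le_card (R := k) ((Finset.range N).image z)
    rw [Finset.coe_image] at this
    exact this.trans (Finset.card_image_le.trans (by simp))
  have h2 := finrank_span_le_card (R := k) ({f} : Set (ι → k))
  have h3 := Submodule.finrank_add_le_finrank_add_finrank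
    (Submodule.span k (z '' (Finset.range N : Set ℕ))) (Submodule.span k {f})
  rw [h, finrank_top, Module.finrank_fintype_fun_eq_card] at h3
  simp at h2
  omega

/-- A tuple in general position can be extended in such a way that the points of the curve
on a span involving the new point avoid a given hyperplane. -/
theorem GenPos.exists_extend_forall_ne_zero [IsAlgClosed k] {Y Z : Set (ι → k)}
    (hY : IsProjVariety k ι Y) (hYn : Nondeg k ι Y) {d : ℕ}
    (hh : ∀ᶠ m in Filter.atTop, Module.finrank k (coordPiece Y m) = d * m)
    (hZ : (vanIdeal k ι Z).IsPrime) (hZn : Nondeg k ι Z) {N : ℕ}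
    {z : ℕ → ι → k} (h : GenPos Y Z 3 N z) (hN3 : 3 ≤ N) (hN : N < Fintype.card ι)
    (hι : 4 < Fintype.card ι) {l : Module.Dual k (ι → k)} (hl : l ≠ 0) :
    ∃ w, GenPos Y Z 3 (N + 1) (Function.update z N w) ∧
      ∀ y ∈ Y, (∃ t : k, t ≠ 0 ∧ y - t • w ∈ Submodule.span k (z '' (Finset.range 3 : Set ℕ))) →
        l y ≠ 0 := by
  classical
  have := hY.prime
  obtain ⟨F, hF, hFl⟩ := exists_finset_cover_hyperplane hYn hh hl
  obtain ⟨w, hw, hG⟩ := h.exists_extend hY hYn hZ hZn hN3 hN (insert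
    (Submodule.span k (z '' (Finset.range 3 : Set ℕ)))
    (F.image fun f => Submodule.span k (z '' (Finset.range 3 : Set ℕ)) ⊔ Submodule.span k {f})) (by
      intro hmem
      rcases Finset.mem_insert.mp hmem with h1 | h1
      · have := span_image_range_sup_ne_top (z := z) (N := 3) (by omega) (0 : ι → k)
        rw [← h1, top_sup_eq] at this
        exact this rfl
      · obtain ⟨f, -, h1⟩ := Finset.mem_image.mp h1
        exact span_image_range_sup_ne_top (by omega) f h1)
  refine ⟨w, hG, ?_⟩
  rintro y hy ⟨t, ht, hyt⟩ hly
  have hwy : w = t⁻¹ • y - t⁻¹ • (y - t • w) := by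
    rw [smul_sub, smul_smul, inv_mul_cancel₀ ht, one_smul]
    abel
  by_cases hy0 : y = 0
  · refine hw _ (Finset.mem_insert_self _ _) ?_
    rw [hwy]
    exact Submodule.sub_mem _ (by simp [hy0]) (Submodule.smul_mem _ _ hyt)
  · obtain ⟨f, hf, μ, rfl⟩ := hFl y hy hly hy0
    refine hw _ (Finset.mem_insert_of_mem (Finset.mem_image_of_mem _ hf)) ?_
    rw [hwy]
    refine Submodule.sub_mem _ (Submodule.mem_sup_right ?_)
      (Submodule.mem_sup_left (Submodule.smul_mem _ _ hyt))
    exact Submodule.smul_mem _ _ (Submodule.smul_mem _ _ (Submodule.mem_span_singleton_self f))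

theorem sum_sub_smul_mem_span {z z' : ℕ → ι → k} (c : ℕ → k) {N : ℕ} {w : ι → k}
    (hz : ∀ i < 3, z' i = z i) (hN : 3 ≤ N) (hw : z' N = w) :
    ∑ i ∈ {0, 1, 2, N}, c i • z' i - c N • w ∈
      Submodule.span k (z '' (Finset.range 3 : Set ℕ)) := by
  have h0 : ∀ i < 3, z' i ∈ Submodule.span k (z '' (Finset.range 3 : Set ℕ)) := fun i hi =>
    Submodule.subset_span ⟨i, by simpa using hi, (hz i hi).symm⟩
  have h1 : ∑ i ∈ {0, 1, 2, N}, c i • z' i - c N • w =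
      c 0 • z' 0 + (c 1 • z' 1 + c 2 • z' 2) := by
    rw [Finset.sum_insert (by simp; omega), Finset.sum_insert (by simp; omega),
      Finset.sum_pair (by omega), hw]
    abel
  rw [h1]
  exact Submodule.add_mem _ (Submodule.smul_mem _ _ (h0 0 (by omega)))
    (Submodule.add_mem _ (Submodule.smul_mem _ _ (h0 1 (by omega)))
      (Submodule.smul_mem _ _ (h0 2 (by omega))))

theorem exists_freeFrom_four [IsAlgClosed k] [CharZero k] {Y Z : Set (ι → k)}
    (hY : IsProjVariety k ι Y)
    (hnd : Nondeg k ι Y) {d : ℕ}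
    (hh : ∀ᶠ m in Filter.atTop, Module.finrank k (coordPiece Y m) = d * m)
    (hZp : (vanIdeal k ι Z).IsPrime) (hZn : Nondeg k ι Z)
    (hZ : Z ⊆ quadZero k ι Y) (hι : 6 ≤ Fintype.card ι)
    (hd : 2 * Fintype.card ι ≤ Module.finrank k (quadrics k ι Y) + 5) {z : ℕ → ι → k}
    (h : GenPos Y Z 3 3 z) : ∃ Q z, Q.card = 4 ∧ FreeFrom Y Z Q z := by
  by_contra! hP
  have hconj : ∀ q ∈ quadrics k ι Y, ∀ z, GenPos Y Z 3 4 z → ∀ a : ℕ → k,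
      (∀ i ∈ ({0, 1, 2, 3} : Finset ℕ), a i ≠ 0) → a 1 = 1 →
      ∑ i ∈ {0, 1, 2, 3}, a i • z i ∈ Y → polarForm q (∑ i ∈ {0, 1, 2, 3}, a i • z i) = 0 := by
    intro q hq z h a ha ha1 hay
    by_contra hl
    obtain ⟨w, hw, hwl⟩ := h.exists_extend_forall_ne_zero hY hnd hh hZp hZn (by omega) (by omega)
      (by omega) hl
    obtain ⟨z', hz', hG⟩ := hw.exists_extend_le hY hnd hZp hZn (by omega) (N := Fintype.card ι)
      (by omega) le_rfl
    have hzz : ∀ i < 4, z' i = z i := fun i hi => by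
      rw [hz' i (by omega), Function.update_of_ne (by omega)]
    obtain ⟨c, hc, hc1, hcy⟩ := hG.exists_relation_eq_one hY.smul_mem hP (Q := {0, 1, 2, 4})
      (by intro m; simp only [Finset.mem_insert, Finset.mem_singleton, Finset.mem_range]; omega)
      rfl (i := 1) (by decide)
    have hs : ∑ i ∈ {0, 1, 2, 3}, a i • z i = ∑ i ∈ {0, 1, 2, 3}, a i • z' i :=
      Finset.sum_congr rfl fun i hi => by
        rw [hzz i (by simp at hi; omega)]
    refine hwl _ hcy ⟨c 4, hc 4 (by decide), sum_sub_smul_mem_span c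
      (fun i hi => hzz i (by omega)) (by omega) ?_⟩ ?_
    · rw [hz' 4 (by omega), Function.update_self]
    · rw [hs] at hay ⊢
      exact polarForm_eq_zero_of_genPos hY hnd hZ hι hd hG hP ha hc ha1 hc1 hay hcy hq
  have h0 : quadrics k ι Y = ⊥ := by
    rw [eq_bot_iff]
    intro q hq
    refine eq_zero_of_polarForm_eq_zero hq.2 fun v => ?_
    by_cases hl : polarForm q v = 0
    · rw [hl]; rfl
    obtain ⟨w, hw, hwl⟩ := h.exists_extend_forall_ne_zero hY hnd hh hZp hZn (by omega) (by omega)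
      (by omega) hl
    obtain ⟨a, ha, ha1, hay⟩ := hw.exists_relation_eq_one hY.smul_mem hP (Q := {0, 1, 2, 3})
      (by intro m; simp only [Finset.mem_insert, Finset.mem_singleton, Finset.mem_range]; omega)
      rfl (i := 1) (by decide)
    refine absurd ?_ (hwl _ hay ⟨a 3, ha 3 (by decide), sum_sub_smul_mem_span a
      (fun i hi => Function.update_of_ne (by omega) _ _) (by omega) (Function.update_self _ _ _)⟩)
    rw [polarForm_comm, hconj q hq _ hw a ha ha1 hay]
    rfl
  rw [h0, finrank_bot] at hd
  omega

/-- A nondegenerate irreducible subset of the base locus of the quadrics through a curve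
of degree `r + 2` and arithmetic genus `1` in `ℙ^r`, `r ≥ 5`, lies on the curve. -/
theorem subset_of_subset_quadZero [IsAlgClosed k] [CharZero k] {Y Z : Set (ι → k)}
    (hY : IsProjVariety k ι Y) (hnd : Nondeg k ι Y) (hι : 6 ≤ Fintype.card ι)
    (hh : ∀ᶠ m in Filter.atTop, Module.finrank k (coordPiece Y m) = (Fintype.card ι + 1) * m)
    (hZp : (vanIdeal k ι Z).IsPrime) (hZn : Nondeg k ι Z) (hZ : Z ⊆ quadZero k ι Y) : Z ⊆ Y := by
  intro x hxZ
  by_contra hxY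
  have hd := le_finrank_quadrics hY hnd (by omega) hh
  rw [Nat.choose_two_right, Nat.add_sub_cancel] at hd
  have hd' : (Fintype.card ι + 1) * Fintype.card ι ≤
      2 * (Module.finrank k (quadrics k ι Y) + 2 * (Fintype.card ι + 1)) + 1 := by omega
  have hd1 : Fintype.card ι < Module.finrank k (quadrics k ι Y) := by nlinarith
  have hd2 : 2 * Fintype.card ι ≤ Module.finrank k (quadrics k ι Y) + 5 := by
    obtain ⟨s, hs⟩ := Nat.exists_eq_add_of_le hι
    rw [hs] at hd' ⊢
    nlinarith
  have hx : FreeFrom Y Z {0} fun _ => x := by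
    refine ⟨fun _ _ => hxZ, ?_, fun y hy hyx => ?_⟩
    · rw [Finset.coe_singleton, linearIndepOn_singleton_iff]
      rintro rfl
      exact hxY hY.zero_mem
    · rw [Finset.coe_singleton, Set.image_singleton] at hyx
      obtain ⟨t, rfl⟩ := Submodule.mem_span_singleton.mp hyx
      by_cases ht : t = 0
      · rw [ht, zero_smul]
      · refine absurd ?_ hxY
        have := hY.smul_mem _ hy t⁻¹
        rwa [smul_smul, inv_mul_cancel₀ ht, one_smul] at this
  obtain ⟨z₁, h₁⟩ := hx.exists_genPos
  obtain ⟨z₁', -, h₁'⟩ := h₁.exists_extend_le hY hnd hZp hZn (t := 0) (by simp)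
    (N := Fintype.card ι) (by rw [Finset.card_singleton]; omega) le_rfl
  obtain ⟨Q₂, z₂, hQ₂, h₂⟩ := exists_freeFrom_two hY hnd hZ (by omega) h₁'
  obtain ⟨w₂, hw₂⟩ := h₂.exists_genPos
  rw [hQ₂] at hw₂
  obtain ⟨w₂', -, hw₂'⟩ := hw₂.exists_extend_le hY hnd hZp hZn (by omega)
    (N := Fintype.card ι) (by omega) le_rfl
  obtain ⟨Q₃, z₃, hQ₃, h₃⟩ := exists_freeFrom_three hY hnd hZ hd1 hw₂'
  obtain ⟨w₃, hw₃⟩ := h₃.exists_genPos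
  rw [hQ₃] at hw₃
  obtain ⟨Q, z, hQ, h⟩ := exists_freeFrom_four hY hnd hh hZp hZn hZ hι hd2 hw₃
  refine not_four_points hY hnd (by omega) hh (α := Q) (by simpa using hQ) (fun i => z i)
    h.indep.linearIndependent (fun f hf i => hZ (h.mem i i.2) f hf) fun y hy hys => ?_
  refine h.disj y hy ?_
  rwa [Set.image_eq_range]

end Uniqueness

/-- Proposition 4.5. Let `C ⊆ ℙ^{1+c}`, `c ≥ 4`, be a nondegenerate
integral curve of arithmetic genus `1` and degree `c + 3`. Then `C` is the only
nondegenerate irreducible component of `Q(C) = Bs(|I_C(2)|)`. -/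
theorem stmt_14 {k : Type} [Field k] [IsAlgClosed k] [CharZero k]
    (c : ℕ) (hc : 4 ≤ c)
    (C : Set (Fin (c + 2) → k))
    (hV : IsProjVariety k (Fin (c + 2)) C)
    (hnd : Nondeg k (Fin (c + 2)) C)
    (hdim : HasDim k (Fin (c + 2)) C 1)
    (hdeg : HasDegree k (Fin (c + 2)) C 1 (c + 3))
    (hgenus : ∀ᶠ m in Filter.atTop,
      (hilb k (Fin (c + 2)) C m : ℤ) = (c + 3) * m + 1 - 1) :
    ∀ Z : Set (Fin (c + 2) → k),
      IsComponentOf k (Fin (c + 2)) Z (quadZero k (Fin (c + 2)) C) →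
      Nondeg k (Fin (c + 2)) Z → Z = C := by
  rintro Z ⟨⟨-, hZp⟩, hZ, hmax⟩ hZn
  have hh : ∀ᶠ m in Filter.atTop,
      Module.finrank k (coordPiece C m) = (Fintype.card (Fin (c + 2)) + 1) * m := by
    filter_upwards [hgenus] with m hm
    rw [finrank_coordPiece, Fintype.card_fin]
    have : (hilb k (Fin (c + 2)) C m : ℤ) = ((c + 2 + 1) * m : ℕ) := by
      rw [hm]
      push_cast
      ring
    exact_mod_cast this
  have hZC := subset_of_subset_quadZero hV hnd (by rw [Fintype.card_fin]; omega) hh hZp hZn hZ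
  exact (hmax C ⟨hV.closed, hV.prime⟩ hZC (subset_quadZero C)).symm
end
end

section
/- Let X ⊂ P^{n+c} be a nondegenerate irreducible projective variety of dimension n with a₂(X) = C(c,2) − k for some 0 ≤ k ≤ c−2. If Y is an irreducible component of Q(X) = Bs(|I_X(2)|) that is nondegenerate in P^{n+c}, then dim Y ≤ n+1. -/
/-!
Common framework: a projective variety `X ⊆ ℙ^N` over a field `k` is represented by its
affine cone `C ⊆ (ι → k)` (with `ι` the index type of homogeneous coordinates,
`Fintype.card ι = N + 1`).  All projective notions (vanishing ideal, `a₂`, Hilbert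
function, dimension, degree, depth, base locus of quadrics, irreducible components,
scrolls and divisors on them, sectional genus, maximal sectional regularity) are
defined concretely below.
-/

open MvPolynomial

noncomputable section

open PaperQuadrics

/-- Over any `k`-algebra `R`, the `R`-span of the image of a `k`-subspace is spanned by the images
of the elements of a `k`-basis. -/
theorem span_image_eq_span_range_basis {k R A M κ : Type*} [CommRing k] [CommRing R] [Algebra k R]
    [AddCommGroup A] [Module k A] [AddCommGroup M] [Module k M] [Module R M] [IsScalarTower k R M]
    (f : A →ₗ[k] M) (C : Submodule k A) (b : Module.Basis κ k C) :
    Submodule.span R (f '' C) = Submodule.span R (Set.range fun i => f (b i)) := by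
  apply le_antisymm
  · rw [Submodule.span_le]
    rintro _ ⟨v, hv, rfl⟩
    have h : (⟨v, hv⟩ : C) ∈ Submodule.span k (Set.range b) := by rw [b.span_eq]; trivial
    have h2 := Submodule.mem_map_of_mem (f := f ∘ₗ C.subtype) h
    rw [Submodule.map_span, ← Set.range_comp] at h2
    exact Submodule.span_le_restrictScalars k R _ h2
  · refine Submodule.span_mono ?_
    rintro _ ⟨i, rfl⟩
    exact ⟨b i, (b i).2, rfl⟩

theorem finrank_span_image_le {k K A M : Type*} [Field k] [Field K] [Algebra k K]
    [AddCommGroup A] [Module k A] [AddCommGroup M] [Module k M] [Module K M] [IsScalarTower k K M]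
    (f : A →ₗ[k] M) (C : Submodule k A) [FiniteDimensional k C] :
    Module.finrank K (Submodule.span K (f '' C)) ≤ Module.finrank k C := by
  rw [span_image_eq_span_range_basis f C (Module.finBasis k C)]
  exact (finrank_range_le_card (R := K) fun i => f (Module.finBasis k C i)).trans_eq
    (Fintype.card_fin _)

section Derivation

variable {k A K M : Type*} [Field k] [CommRing A] [Algebra k A] [AddCommGroup M] [Module k M]
  [Module A M] (D : Derivation k A M)

theorem Derivation.apply_mul_mem_smul_span {W V : Submodule k A} (hWV : W ≤ V) {I : Ideal A}
    (hI : ∀ w ∈ W, w ∈ I) {a : A} (ha : a ∈ W * W) :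
    D a ∈ I • Submodule.span A (D '' V) := by
  induction ha using Submodule.mul_induction_on' with
  | mem_mul_mem m hm n hn =>
    rw [D.leibniz]
    exact add_mem
      (Submodule.smul_mem_smul (hI m hm) (Submodule.subset_span ⟨n, hWV hn, rfl⟩))
      (Submodule.smul_mem_smul (hI n hn) (Submodule.subset_span ⟨m, hWV hm, rfl⟩))
  | add x _ y _ hx hy => rw [map_add]; exact add_mem hx hy

variable [Field K] [Algebra A K] [Module K M] [IsScalarTower k A M] [IsScalarTower A K M]

/-- Nakayama at a rational point: the differentials of elements `v ∈ V` with `x v ∈ W²`, where `W`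
vanishes at the point and `x` does not, are redundant. -/
theorem span_derivation_le_of_mul_mem [FaithfulSMul A K] (ε : A →ₐ[k] k)
    {V W N C : Submodule k A} [FiniteDimensional k V] (hWV : W ≤ V) (hW : ∀ w ∈ W, ε w = 0)
    {x : A} (hxV : x ∈ V) (hx : ε x = 1) (hNV : N ≤ V) (hN : ∀ v ∈ N, x * v ∈ W * W) (hV : V ≤ N ⊔ C) :
    Submodule.span K (D '' V) ≤ Submodule.span K (D '' C) := by
  set I : Ideal A := RingHom.ker ε with hI
  have hWI : ∀ w ∈ W, w ∈ I := fun w hw => hW w hw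
  have hWWI : ∀ w ∈ W * W, ε w = 0 := by
    intro w hw
    induction hw using Submodule.mul_induction_on' with
    | mem_mul_mem m hm n hn => simp [hW m hm]
    | add x _ y _ hx hy => simp [hx, hy]
  have hfg : (Submodule.span A (D '' V)).FG := by
    have := span_image_eq_span_range_basis (R := A) D.toLinearMap V (Module.finBasis k V)
    have h2 : Submodule.span A (D '' V) = _ := this
    rw [h2]
    exact Submodule.fg_span (Set.finite_range _)
  have hle : Submodule.span A (D '' V) ≤
      Submodule.span A (D '' C) ⊔ I • Submodule.span A (D '' V) := by
    rw [Submodule.span_le]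
    rintro _ ⟨v, hv, rfl⟩
    obtain ⟨n, hn, c, hc, rfl⟩ := Submodule.mem_sup.mp (hV hv)
    rw [map_add]
    refine add_mem (Submodule.mem_sup_right ?_)
      (Submodule.mem_sup_left (Submodule.subset_span ⟨c, hc, rfl⟩))
    have hDn : D n ∈ Submodule.span A (D '' V) := Submodule.subset_span ⟨n, hNV hn, rfl⟩
    have hDx := D.apply_mul_mem_smul_span hWV hWI (hN n hn)
    rw [D.leibniz] at hDx
    have hnI : n ∈ I := by
      have := hWWI _ (hN n hn)
      rwa [map_mul, hx, one_mul] at this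
    have h1 : n • D x ∈ I • Submodule.span A (D '' V) :=
      Submodule.smul_mem_smul hnI (Submodule.subset_span ⟨x, hxV, rfl⟩)
    have hxI : x - 1 ∈ I := by rw [hI, RingHom.mem_ker, map_sub, map_one, hx, sub_self]
    have h2 : (x - 1) • D n ∈ I • Submodule.span A (D '' V) := Submodule.smul_mem_smul hxI hDn
    have h3 := sub_mem (sub_mem hDx h1) h2
    rwa [add_sub_cancel_right, sub_smul, one_smul, sub_sub_cancel] at h3
  obtain ⟨r, hr, hrle⟩ :=
    Submodule.exists_sub_one_mem_and_smul_le_of_fg_of_le_sup hfg le_rfl hle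
  have hr0 : algebraMap A K r ≠ 0 := by
    intro h
    rw [map_eq_zero_iff _ (FaithfulSMul.algebraMap_injective A K)] at h
    rw [h, hI, RingHom.mem_ker] at hr
    simp at hr
  rw [Submodule.span_le]
  rintro _ ⟨v, hv, rfl⟩
  have h1 : r • D v ∈ Submodule.span A (D '' C) :=
    hrle (Submodule.smul_mem_pointwise_smul _ _ _ (Submodule.subset_span ⟨v, hv, rfl⟩))
  have h2 : r • D v ∈ Submodule.span K (D '' C) := Submodule.span_le_restrictScalars A K _ h1
  rw [← algebraMap_smul K r] at h2
  exact (Submodule.smul_mem_iff _ hr0).mp h2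

variable [Algebra k K] [IsScalarTower k K M]

/-- A Freiman-type lower bound for the dimension of the square of a finite-dimensional space `V` of
functions separated by rational points, in terms of the rank of the differentials of `V`. -/
theorem finrank_mul_finrank_le_finrank_mul_self [IsDomain A] [FaithfulSMul A K]
    [Module.Finite K M] (V : Submodule k A) [FiniteDimensional k V]
    (hpt : ∀ v ∈ V, v ≠ 0 → ∃ ε : A →ₐ[k] k, ε v ≠ 0) :
    Module.finrank K (Submodule.span K (D '' V)) * Module.finrank k V ≤
      Module.finrank k (V * V : Submodule k A) +
        (Module.finrank K (Submodule.span K (D '' V))).choose 2 := by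
  induction hr : Module.finrank k V generalizing V with
  | zero => simp
  | succ n ih =>
    obtain ⟨x₀, hx₀V, hx₀⟩ : ∃ x ∈ V, x ≠ 0 := by
      by_contra! h
      have : V = ⊥ := (Submodule.eq_bot_iff V).mpr h
      rw [this, finrank_bot] at hr
      omega
    obtain ⟨ε, hε⟩ := hpt x₀ hx₀V hx₀
    obtain ⟨x, hxV, hx⟩ : ∃ x ∈ V, ε x = 1 :=
      ⟨(ε x₀)⁻¹ • x₀, V.smul_mem _ hx₀V, by rw [map_smul, smul_eq_mul, inv_mul_cancel₀ hε]⟩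
    have hx0 : x ≠ 0 := by rintro rfl; simp at hx
    set W : Submodule k A := V ⊓ LinearMap.ker ε.toLinearMap with hWdef
    have hWV : W ≤ V := inf_le_left
    have hWε : ∀ w ∈ W, ε w = 0 := fun w hw => hw.2
    have hVW : ∀ v ∈ V, v - ε v • x ∈ W := fun v hv =>
      ⟨sub_mem hv (V.smul_mem _ hxV), by simp [hx]⟩
    have hVsup : V = Submodule.span k {x} ⊔ W := by
      apply le_antisymm
      · intro v hv
        rw [← add_sub_cancel (ε v • x) v]
        exact Submodule.add_mem_sup
          (Submodule.smul_mem _ _ (Submodule.mem_span_singleton_self x)) (hVW v hv)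
      · exact sup_le ((Submodule.span_singleton_le_iff_mem _ _).mpr hxV) hWV
    have hWfin : FiniteDimensional k W := Submodule.finiteDimensional_of_le hWV
    have hdisj : Submodule.span k {x} ⊓ W = ⊥ := by
      rw [Submodule.eq_bot_iff]
      rintro v ⟨hv1, hv2⟩
      obtain ⟨a, rfl⟩ := Submodule.mem_span_singleton.mp hv1
      have := hWε _ hv2
      rw [map_smul, hx, smul_eq_mul, mul_one] at this
      rw [this, zero_smul]
    have hWr : Module.finrank k W = n := by
      have h := Submodule.finrank_sup_add_finrank_inf_eq (Submodule.span k {x}) W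
      rw [← hVsup, hdisj, finrank_bot, finrank_span_singleton hx0, hr] at h
      omega
    have hIH := ih W (fun v hv => hpt v (hWV hv)) hWr
    let φ : A →ₗ[k] A := LinearMap.mulLeft k x
    have hφ : Function.Injective φ := fun a b h => mul_left_cancel₀ hx0 h
    set N : Submodule k A := V ⊓ (W * W).comap φ with hNdef
    have hNV : N ≤ V := inf_le_left
    have hNfin : FiniteDimensional k N := Submodule.finiteDimensional_of_le hNV
    have hNW : ∀ v ∈ N, x * v ∈ W * W := fun v hv => hv.2
    have hWW : W * W ≤ V * V := mul_le_mul' hWV hWV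
    have hdim : n + 1 + Module.finrank k (W * W : Submodule k A) ≤
        Module.finrank k (V * V : Submodule k A) + Module.finrank k N := by
      have hVVfin : FiniteDimensional k (V * V : Submodule k A) :=
        .of_fg (.mul (Submodule.fg_iff_finiteDimensional _ |>.mpr inferInstance)
          (Submodule.fg_iff_finiteDimensional _ |>.mpr inferInstance))
      have hWWfin : FiniteDimensional k (W * W : Submodule k A) :=
        .of_fg (.mul (Submodule.fg_iff_finiteDimensional _ |>.mpr inferInstance)
          (Submodule.fg_iff_finiteDimensional _ |>.mpr inferInstance))
      have h1 : V.map φ ⊔ W * W ≤ V * V := by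
        refine sup_le ?_ hWW
        rintro _ ⟨v, hv, rfl⟩
        exact Submodule.mul_mem_mul hxV hv
      have h2 : V.map φ ⊓ W * W = N.map φ := by
        ext a
        constructor
        · rintro ⟨⟨v, hv, rfl⟩, h⟩
          exact ⟨v, ⟨hv, h⟩, rfl⟩
        · rintro ⟨v, ⟨hv, h⟩, rfl⟩
          exact ⟨⟨v, hv, rfl⟩, h⟩
      have h3 := Submodule.finrank_sup_add_finrank_inf_eq (V.map φ) (W * W)
      rw [h2, ← (Submodule.equivMapOfInjective φ hφ V).finrank_eq,
        ← (Submodule.equivMapOfInjective φ hφ N).finrank_eq, hr] at h3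
      have h4 := Submodule.finrank_mono h1
      omega
    have hspanle : Submodule.span K (D '' W) ≤ Submodule.span K (D '' V) :=
      Submodule.span_mono (Set.image_mono hWV)
    have hspan : Submodule.span K (D '' V) =
        Submodule.span K {D x} ⊔ Submodule.span K (D '' W) := by
      apply le_antisymm
      · rw [Submodule.span_le]
        rintro _ ⟨v, hv, rfl⟩
        rw [← add_sub_cancel (ε v • x) v, map_add, D.map_smul, ← algebraMap_smul K (ε v)]
        exact Submodule.add_mem_sup
          (Submodule.smul_mem _ _ (Submodule.mem_span_singleton_self _))
          (Submodule.subset_span ⟨_, hVW v hv, rfl⟩)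
      · refine sup_le ((Submodule.span_singleton_le_iff_mem _ _).mpr ?_) hspanle
        exact Submodule.subset_span ⟨x, hxV, rfl⟩
    by_cases hDx : D x ∈ Submodule.span K (D '' W)
    · have hTT : Submodule.span K (D '' V) = Submodule.span K (D '' W) := by
        rw [hspan, sup_eq_right, Submodule.span_singleton_le_iff_mem]
        exact hDx
      obtain ⟨C, hCV, hNC, hNCV⟩ : ∃ C ≤ V, N ⊓ C = ⊥ ∧ N ⊔ C = V := by
        obtain ⟨C, hC, hCV⟩ := IsModularLattice.exists_disjoint_and_sup_eq hNV
        exact ⟨C, hCV ▸ le_sup_right, hC.eq_bot, hCV⟩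
      have hCfin : FiniteDimensional k C := Submodule.finiteDimensional_of_le hCV
      have h1 := span_derivation_le_of_mul_mem (K := K) D ε hWV hWε hxV hx hNV hNW hNCV.ge
      have h2 := (Submodule.finrank_mono h1).trans (finrank_span_image_le D.toLinearMap C)
      have h3 := Submodule.finrank_sup_add_finrank_inf_eq N C
      rw [hNC, hNCV, finrank_bot, hr] at h3
      rw [← hTT] at hIH
      rw [mul_add, mul_one]
      omega
    · have hN0 : N = ⊥ := by
        rw [Submodule.eq_bot_iff]
        intro v hv
        by_contra hv0
        have hWWε : ∀ w ∈ W * W, ε w = 0 := fun w hw =>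
          Submodule.mul_induction_on hw (fun a ha b _ => by simp [hWε a ha])
            (fun a b ha hb => by simp [ha, hb])
        have hvW : v ∈ W := ⟨hNV hv, by simpa [hx] using hWWε _ (hNW v hv)⟩
        have h1 : D (x * v) ∈ Submodule.span K (D '' W) :=
          Submodule.span_le_restrictScalars A K _ (Submodule.smul_le_right
            (D.apply_mul_mem_smul_span le_rfl (fun w _ => Submodule.mem_top (x := w)) (hNW v hv)))
        have h2 : x • D v ∈ Submodule.span K (D '' W) := by
          rw [← algebraMap_smul K x]
          exact Submodule.smul_mem _ _ (Submodule.subset_span ⟨v, hvW, rfl⟩)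
        rw [D.leibniz] at h1
        have h3 := sub_mem h1 h2
        rw [add_sub_cancel_left, ← algebraMap_smul K v] at h3
        refine hDx ((Submodule.smul_mem_iff _ ?_).mp h3)
        rwa [Ne, map_eq_zero_iff _ (FaithfulSMul.algebraMap_injective A K)]
      have hδ : Module.finrank K (Submodule.span K (D '' V)) =
          Module.finrank K (Submodule.span K (D '' W)) + 1 := by
        rw [hspan, sup_comm, Submodule.finrank_sup_span_singleton hDx]
      rw [hN0, finrank_bot] at hdim
      rw [hδ, Nat.choose_succ_succ' _ 1, Nat.choose_one_right]
      nlinarith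

end Derivation

theorem ringKrullDim_le_of_isIntegral (R S : Type*) [CommRing R] [CommRing S] [Algebra R S]
    [Algebra.IsIntegral R S] : ringKrullDim S ≤ ringKrullDim R := by
  refine Order.krullDim_le_of_strictMono (PrimeSpectrum.comap (algebraMap R S)) fun p q hpq => ?_
  have h : p.asIdeal < q.asIdeal := hpq
  exact Ideal.IsIntegral.comap_lt_comap (R := R) h

open KaehlerDifferential in
/-- In characteristic zero, the Krull dimension of an affine domain is at most the rank of its
differentials over the fraction field. -/
theorem exists_linearIndependent_kaehlerDifferential (k A : Type) [Field k] [CharZero k]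
    [CommRing A] [IsDomain A] [Algebra k A] [Algebra.FiniteType k A] :
    ∃ (s : ℕ) (y : Fin s → A), Module.Finite (FractionRing A) Ω[FractionRing A⁄k] ∧
      LinearIndependent (FractionRing A)
        (fun i => D k (FractionRing A) (algebraMap A (FractionRing A) (y i))) ∧
      ringKrullDim A ≤ s := by
  obtain ⟨s, g, hg, hgfin⟩ := exists_finite_inj_algHom_of_fg k A
  let S := MvPolynomial (Fin s) k
  let K := FractionRing A
  let L := FractionRing S
  let _ : Algebra S A := g.toRingHom.toAlgebra
  have : IsScalarTower k S A := .of_algebraMap_eq fun r => (g.commutes r).symm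
  have : Module.Finite S A := hgfin
  have : FaithfulSMul S A := (faithfulSMul_iff_algebraMap_injective S A).mpr hg
  have : IsScalarTower k S K := .of_algebraMap_eq fun r => by
    rw [IsScalarTower.algebraMap_apply k A K, IsScalarTower.algebraMap_apply k S A,
      ← IsScalarTower.algebraMap_apply S A K]
  have : FaithfulSMul S K := FaithfulSMul.trans S A K
  let _ : Algebra L K := FractionRing.liftAlgebra S K
  have : IsScalarTower S L K := inferInstance
  have : Algebra.IsAlgebraic L K := inferInstance
  have : CharZero L := charZero_of_injective_algebraMap (algebraMap k L).injective
  have : Algebra.FormallyEtale L K := Algebra.FormallyEtale.of_isSeparable L K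
  have : Algebra.FormallyEtale S L := Algebra.FormallyEtale.of_isLocalization (nonZeroDivisors S)
  have : Algebra.FormallyEtale S K := .comp S L K
  let e := tensorKaehlerEquivOfFormallyEtale k S K
  let b := ((mvPolynomialBasis k (Fin s)).baseChange K).map e
  refine ⟨s, fun i => g (.X i), Module.Finite.of_basis b, ?_, ?_⟩
  · convert b.linearIndependent using 2 with i
    simp [b, e]
    rw [mapBaseChange_tmul, one_smul, map_D]
    rfl
  · refine (ringKrullDim_le_of_isIntegral S A).trans ?_
    simp [S, MvPolynomial.ringKrullDim_of_isNoetherianRing]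

theorem Nat.choose_two_add_add_one (j δ : ℕ) :
    (j + δ + 1).choose 2 + δ.choose 2 = (j + 1).choose 2 + δ * (δ + j) := by
  induction δ with
  | zero => simp
  | succ δ ih =>
    rw [show j + (δ + 1) + 1 = (j + δ + 1) + 1 by ring, Nat.choose_succ_succ' _ 1,
      Nat.choose_succ_succ' δ 1, Nat.choose_one_right, Nat.choose_one_right]
    nlinarith

theorem finrank_homogeneousSubmodule_two_le (k ι : Type) [Field k] [Fintype ι] :
    Module.finrank k (homogeneousSubmodule ι k 2) ≤ (Fintype.card ι + 1).choose 2 := by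
  let f : Sym2 ι → MvPolynomial ι k :=
    Sym2.lift ⟨fun i j => X i * X j, fun i j => mul_comm _ _⟩
  have hle : homogeneousSubmodule ι k 2 ≤ Submodule.span k (Set.range f) := by
    rw [← homogeneousSubmodule_one_pow, pow_two, homogeneousSubmodule_one_eq_span_X,
      Submodule.span_mul_span, Submodule.span_le]
    rintro _ ⟨_, ⟨i, rfl⟩, _, ⟨j, rfl⟩, rfl⟩
    exact Submodule.subset_span ⟨s(i, j), rfl⟩
  have hfin : FiniteDimensional k (Submodule.span k (Set.range f)) :=
    .of_fg (Submodule.fg_span (Set.finite_range f))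
  refine (Submodule.finrank_mono hle).trans ((finrank_range_le_card f).trans_eq ?_)
  rw [← Nat.card_eq_fintype_card, Sym2.natCard, Nat.card_eq_fintype_card]

namespace PaperQuadrics

theorem mem_vanIdeal {k ι : Type} [Field k] [Fintype ι] [DecidableEq ι] {Z : Set (ι → k)}
    {f : MvPolynomial ι k} : f ∈ vanIdeal k ι Z ↔ ∀ x ∈ Z, MvPolynomial.eval x f = 0 := by
  simp [vanIdeal, Submodule.mem_iInf, RingHom.mem_ker]

/-- Castelnuovo's bound on the number of quadrics through a nondegenerate irreducible set,
in terms of an upper bound `δ` for the dimension of its affine cone. -/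
theorem exists_a2_add_le {k ι : Type} [Field k] [CharZero k] [Fintype ι] [DecidableEq ι]
    (Z : Set (ι → k)) (hprime : (vanIdeal k ι Z).IsPrime) (hnd : Nondeg k ι Z) :
    ∃ δ : ℕ, ringKrullDim (MvPolynomial ι k ⧸ vanIdeal k ι Z) ≤ δ ∧ δ ≤ Fintype.card ι ∧
      a2 k ι Z + δ * Fintype.card ι ≤ (Fintype.card ι + 1).choose 2 + δ.choose 2 := by
  set P := vanIdeal k ι Z with hP
  let A := MvPolynomial ι k ⧸ P
  let K := FractionRing A
  let π : MvPolynomial ι k →ₐ[k] A := Ideal.Quotient.mkₐ k P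
  have hπ : ∀ f, π f = 0 ↔ f ∈ P := fun f => Ideal.Quotient.eq_zero_iff_mem
  have hπs : Function.Surjective π := Ideal.Quotient.mkₐ_surjective k P
  let V : Submodule k A := (homogeneousSubmodule ι k 1).map π.toLinearMap
  have hVspan : V = Submodule.span k (Set.range fun i => π (X i)) := by
    simp only [V, homogeneousSubmodule_one_eq_span_X, Submodule.map_span, ← Set.range_comp]
    rfl
  have hVfin : FiniteDimensional k V := by
    rw [hVspan]
    exact .of_fg (Submodule.fg_span (Set.finite_range _))
  have hVr : Module.finrank k V = Fintype.card ι := by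
    have hli : LinearIndependent k (X : ι → MvPolynomial ι k) := linearIndependent_X ι k
    have hli' : LinearIndependent k (fun i => π (X i)) := by
      refine hli.map (f := π.toLinearMap) ?_
      rw [← homogeneousSubmodule_one_eq_span_X, Submodule.disjoint_def]
      intro f hf hf0
      exact hnd f hf (mem_vanIdeal.mp ((hπ f).mp hf0))
    rw [hVspan, finrank_span_eq_card hli']
  have hpt : ∀ v ∈ V, v ≠ 0 → ∃ ε : A →ₐ[k] k, ε v ≠ 0 := by
    rintro _ ⟨f, -, rfl⟩ hf
    have hf' : f ∉ P := fun h => hf ((hπ f).mpr h)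
    rw [hP, mem_vanIdeal] at hf'
    push Not at hf'
    obtain ⟨x, hx, hfx⟩ := hf'
    refine ⟨Ideal.Quotient.liftₐ P (MvPolynomial.aeval x) fun a ha => ?_, ?_⟩
    · simpa [MvPolynomial.aeval_eq_eval] using mem_vanIdeal.mp ha x hx
    · change ¬ MvPolynomial.aeval x f = 0
      simpa [MvPolynomial.aeval_eq_eval] using hfx
  obtain ⟨s, y, hΩ, hy, hs⟩ := exists_linearIndependent_kaehlerDifferential k A
  let D : Derivation k A (KaehlerDifferential k K) :=
    (KaehlerDifferential.D k K).compAlgebraMap A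
  have hD : ∀ a, D a ∈ Submodule.span K (D '' V) := by
    intro a
    obtain ⟨f, rfl⟩ := hπs a
    induction f using MvPolynomial.induction_on with
    | C c =>
      have : π (C c) = algebraMap k A c := π.commutes c
      rw [this, D.map_algebraMap]
      exact zero_mem _
    | add p q hp hq => rw [map_add, map_add]; exact add_mem hp hq
    | mul_X p i hp =>
      rw [map_mul, D.leibniz, ← algebraMap_smul K (π p), ← algebraMap_smul K (π (X i))]
      refine add_mem (Submodule.smul_mem _ _ (Submodule.subset_span ⟨_, ?_, rfl⟩))
        (Submodule.smul_mem _ _ hp)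
      exact ⟨X i, isHomogeneous_X k i, rfl⟩
  have hsδ : s ≤ Module.finrank K (Submodule.span K (D '' V)) := by
    have h := finrank_span_eq_card hy
    rw [Fintype.card_fin] at h
    rw [← h]
    refine Submodule.finrank_mono (Submodule.span_le.mpr ?_)
    rintro _ ⟨i, rfl⟩
    exact hD (y i)
  have hfreiman := finrank_mul_finrank_le_finrank_mul_self (K := K) D V hpt
  have hδr := finrank_span_image_le (K := K) D.toLinearMap V
  rw [hVr] at hfreiman hδr
  refine ⟨_, hs.trans (by exact_mod_cast hsδ), hδr, ?_⟩
  have hS2 : FiniteDimensional k (homogeneousSubmodule ι k 2) :=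
    .of_fg (homogeneousSubmodule_fg ι k 2)
  have hsum : Module.finrank k (V * V : Submodule k A) + a2 k ι Z =
      Module.finrank k (homogeneousSubmodule ι k 2) := by
    let ψ := π.toLinearMap.domRestrict (homogeneousSubmodule ι k 2)
    rw [← LinearMap.finrank_range_add_finrank_ker ψ]
    congr 1
    · have : V * V = LinearMap.range ψ := by
        rw [LinearMap.range_domRestrict, ← homogeneousSubmodule_one_pow, pow_two,
          Submodule.map_mul]
      rw [this]
    · have : quadrics k ι Z = (LinearMap.ker ψ).map (homogeneousSubmodule ι k 2).subtype := by
        ext f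
        constructor
        · rintro ⟨hf, hf2⟩
          exact ⟨⟨f, hf2⟩, (hπ f).mpr hf, rfl⟩
        · rintro ⟨⟨f, hf2⟩, hf, rfl⟩
          exact ⟨(hπ f).mp hf, hf2⟩
      rw [a2, this]
      exact (Submodule.equivMapOfInjective _ (Submodule.injective_subtype _) _).finrank_eq.symm
  have hle := finrank_homogeneousSubmodule_two_le k ι
  have h1 : Module.finrank K (Submodule.span K (D '' V)) * Fintype.card ι ≤ _ := hfreiman
  change _ + Module.finrank K (Submodule.span K (D '' V)) * _ ≤
    _ + (Module.finrank K (Submodule.span K (D '' V))).choose 2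
  omega

theorem a2_le_of_subset_quadZero {k ι : Type} [Field k] [Fintype ι] [DecidableEq ι]
    {C Y : Set (ι → k)} (h : Y ⊆ quadZero k ι C) : a2 k ι C ≤ a2 k ι Y := by
  have hfin : FiniteDimensional k (homogeneousSubmodule ι k 2) :=
    .of_fg (homogeneousSubmodule_fg ι k 2)
  have hfinY : FiniteDimensional k (quadrics k ι Y) :=
    Submodule.finiteDimensional_of_le (inf_le_right : quadrics k ι Y ≤ homogeneousSubmodule ι k 2)
  exact Submodule.finrank_mono fun f hf =>
    ⟨mem_vanIdeal.mpr fun x hx => h hx f hf, hf.2⟩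

end PaperQuadrics

/-- Proposition 5.3.(1). Let `X ⊆ ℙ^{n+c}` be nondegenerate irreducible
of dimension `n` with `a₂(X) = C(c,2) - K`, `0 ≤ K ≤ c - 2`. If `Y` is a nondegenerate
irreducible component of `Q(X)`, then `dim Y ≤ n + 1` (i.e. the affine cone of `Y` has
Krull dimension at most `n + 2`). -/
theorem stmt_15 {k : Type} [Field k] [IsAlgClosed k] [CharZero k]
    (n c K : ℕ) (hK : K ≤ c - 2) (hc : 2 ≤ c)
    (C Y : Set (Fin (n + c + 1) → k))
    (hV : IsProjVariety k (Fin (n + c + 1)) C)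
    (hnd : Nondeg k (Fin (n + c + 1)) C)
    (hdim : HasDim k (Fin (n + c + 1)) C n)
    (ha : a2 k (Fin (n + c + 1)) C = Nat.choose c 2 - K)
    (hY : IsComponentOf k (Fin (n + c + 1)) Y (quadZero k (Fin (n + c + 1)) C))
    (hYnd : Nondeg k (Fin (n + c + 1)) Y) :
    ringKrullDim (MvPolynomial (Fin (n + c + 1)) k ⧸ vanIdeal k (Fin (n + c + 1)) Y) ≤
      ((n + 2 : ℕ) : WithBot ℕ∞) := by
  obtain ⟨δ, hδ, hδr, hbound⟩ := exists_a2_add_le Y hY.1.2 hYnd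
  have hle := a2_le_of_subset_quadZero hY.2.1
  rw [Fintype.card_fin] at hδr hbound
  rw [ha] at hle
  refine hδ.trans ?_
  suffices h : δ ≤ n + 2 by exact_mod_cast h
  by_contra! hlt
  obtain ⟨j, hj⟩ := Nat.exists_eq_add_of_le' hδr
  have hid := Nat.choose_two_add_add_one j δ
  rw [← hj, show δ + j = n + c + 1 by omega] at hid
  have hmono : (j + 1).choose 2 ≤ (c - 1).choose 2 := Nat.choose_le_choose 2 (by omega)
  obtain ⟨b, rfl⟩ : ∃ b, c = b + 1 := ⟨c - 1, by omega⟩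
  rw [Nat.choose_succ_succ' b 1, Nat.choose_one_right, one_add_one_eq_two] at hle
  rw [Nat.add_sub_cancel] at hmono
  omega
end
end
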